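/- arXiv:2101.00726 — 4 statements merged into one kernel-verified Lean document; each statement's English description precedes it below -/
import Mathlib

section
/- Let P be a Borel probability measure on ℝ^d, δ ∈ (0,∞), and z, u ∈ ℝ^d with ‖u‖ = 1. Let X be a random vector with law P and set Y = ⟨u, z − X⟩. Then sup_{P' : d_W(P',P) ≤ δ} P'({x : ⟨u, x − z⟩ ≥ 0}) = inf_{λ' > 0} { δ/λ' + E[(1 − Y⁺/λ')⁺] }, and this infimum is attained at λ = h⁻¹(δ) ∈ (0,∞], so that the value equals δ/λ + E[(1 − Y⁺/λ)⁺] (interpreted as 1 when λ = ∞); moreover, when λ < ∞ the value also equals P(Y ≤ λ) − (h(λ) − δ)/λ and equals P(Y < λ) + (δ − h(λ−))/λ. -/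
open MeasureTheory RealInnerProductSpace
open scoped ENNReal

abbrev Ed (d : ℕ) := EuclideanSpace ℝ (Fin d)

/-- 1-Wasserstein distance between Borel measures on `ℝ^d`. -/
noncomputable def wassersteinDist {d : ℕ} (P Q : Measure (Ed d)) : ℝ≥0∞ :=
  ⨅ (π : Measure (Ed d × Ed d)) (_ : π.map Prod.fst = P) (_ : π.map Prod.snd = Q),
    ∫⁻ p, ENNReal.ofReal ‖p.1 - p.2‖ ∂π

/-- Worst-case probability of a set over the Wasserstein ball of radius `δ` around `P`. -/
noncomputable def supProb {d : ℕ} (δ : ℝ) (P : Measure (Ed d)) (A : Set (Ed d)) : ℝ :=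
  sSup {v : ℝ | ∃ Q : Measure (Ed d), IsProbabilityMeasure Q ∧
    wassersteinDist Q P ≤ ENNReal.ofReal δ ∧ v = (Q A).toReal}

/-- Shift `x` along the unit vector `u` onto the halfspace `{x | 0 ≤ ⟪u, x - z⟫}`. -/
noncomputable def shiftOnto {d : ℕ} (z u x : Ed d) : Ed d := x + max ⟪u, z - x⟫ 0 • u

lemma measurable_slack {d : ℕ} (z u : Ed d) : Measurable fun x : Ed d => ⟪u, z - x⟫ := by
  have : Continuous fun x : Ed d => ⟪u, z - x⟫ := by fun_prop
  exact this.measurable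

lemma measurable_shiftOnto {d : ℕ} (z u : Ed d) : Measurable (shiftOnto z u) := by
  have : Continuous (shiftOnto z u) := by unfold shiftOnto; fun_prop
  exact this.measurable

lemma shiftOnto_mem {d : ℕ} (z u x : Ed d) (hu : ‖u‖ = 1) : 0 ≤ ⟪u, shiftOnto z u x - z⟫ := by
  have h1 : ⟪u, u⟫ = 1 := by rw [real_inner_self_eq_norm_sq, hu]; norm_num
  have h2 : shiftOnto z u x - z = max ⟪u, z - x⟫ 0 • u - (z - x) := by
    unfold shiftOnto; abel
  rw [h2, inner_sub_right, inner_smul_right, h1, mul_one, sub_nonneg]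
  exact le_max_left _ _

lemma norm_shiftOnto_sub {d : ℕ} (z u x : Ed d) (hu : ‖u‖ = 1) :
    ‖shiftOnto z u x - x‖ = max ⟪u, z - x⟫ 0 := by
  unfold shiftOnto
  rw [add_sub_cancel_left, norm_smul, hu, mul_one, Real.norm_of_nonneg (le_max_right _ _)]

lemma measurableSet_halfspace {d : ℕ} (z u : Ed d) :
    MeasurableSet {x : Ed d | 0 ≤ ⟪u, x - z⟫} := by
  have : Continuous fun x : Ed d => ⟪u, x - z⟫ := by fun_prop
  exact measurableSet_le measurable_const this.measurable

/-- Weak duality for the worst-case probability of a halfspace. -/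
lemma measure_halfspace_le {d : ℕ} (P Q : Measure (Ed d)) [IsProbabilityMeasure P]
    {δ : ℝ} (hδ : 0 < δ) (z u : Ed d) (hu : ‖u‖ = 1)
    (hQ : wassersteinDist Q P ≤ ENNReal.ofReal δ) {l : ℝ} (hl : 0 < l) :
    (Q {x | 0 ≤ ⟪u, x - z⟫}).toReal ≤
      δ / l + ∫ x, max (1 - max ⟪u, z - x⟫ 0 / l) 0 ∂P := by
  have hmY := measurable_slack z u
  have hmg : Measurable fun x : Ed d => max (1 - max ⟪u, z - x⟫ 0 / l) 0 := by fun_prop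
  have hint : Integrable (fun x : Ed d => max (1 - max ⟪u, z - x⟫ 0 / l) 0) P := by
    refine Integrable.of_bound hmg.aestronglyMeasurable 1 (.of_forall fun x => ?_)
    rw [Real.norm_of_nonneg (le_max_right _ _)]
    have : 0 ≤ max ⟪u, z - x⟫ 0 / l := by positivity
    exact max_le (by linarith) zero_le_one
  have hI : 0 ≤ ∫ x, max (1 - max ⟪u, z - x⟫ 0 / l) 0 ∂P :=
    integral_nonneg fun x => le_max_right _ _
  refine ENNReal.toReal_le_of_le_ofReal (by positivity) ?_
  rw [ENNReal.ofReal_add (by positivity) hI,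
    ofReal_integral_eq_lintegral_ofReal hint (.of_forall fun x => le_max_right _ _)]
  have hcoup : ∀ π : Measure (Ed d × Ed d), π.map Prod.fst = Q → π.map Prod.snd = P →
      Q {x | 0 ≤ ⟪u, x - z⟫} ≤ ENNReal.ofReal l⁻¹ * (∫⁻ p, ENNReal.ofReal ‖p.1 - p.2‖ ∂π) +
        ∫⁻ x, ENNReal.ofReal (max (1 - max ⟪u, z - x⟫ 0 / l) 0) ∂P := by
    intro π h1 h2
    have hA := measurableSet_halfspace z u
    rw [← h1, ← h2, lintegral_map hmg.ennreal_ofReal measurable_snd,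
      ← lintegral_const_mul _ (by fun_prop), ← lintegral_add_right _ (by fun_prop),
      ← lintegral_indicator_one hA, lintegral_map (measurable_one.indicator hA) measurable_fst]
    refine lintegral_mono fun p => ?_
    by_cases hp : 0 ≤ ⟪u, p.1 - z⟫
    · rw [Set.indicator_of_mem (by exact hp), ← ENNReal.ofReal_mul (by positivity),
        ← ENNReal.ofReal_add (by positivity) (le_max_right _ _)]
      refine ENNReal.one_le_ofReal.2 ?_
      have hY : max ⟪u, z - p.2⟫ 0 ≤ ‖p.1 - p.2‖ := by
        refine max_le ?_ (norm_nonneg _)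
        have h3 : z - p.2 = (p.1 - p.2) - (p.1 - z) := by abel
        have h4 := real_inner_le_norm u (p.1 - p.2)
        rw [hu, one_mul] at h4
        rw [h3, inner_sub_right]
        linarith
      have h5 : max ⟪u, z - p.2⟫ 0 / l ≤ l⁻¹ * ‖p.1 - p.2‖ := by
        rw [div_eq_inv_mul]; gcongr
      have h6 := le_max_left (1 - max ⟪u, z - p.2⟫ 0 / l) 0
      linarith
    · rw [Set.indicator_of_notMem (by exact hp)]
      exact zero_le
  have hc0 : ENNReal.ofReal l⁻¹ ≠ 0 := (ENNReal.ofReal_pos.2 (inv_pos.2 hl)).ne'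
  have hdiv : (Q {x | 0 ≤ ⟪u, x - z⟫} -
      ∫⁻ x, ENNReal.ofReal (max (1 - max ⟪u, z - x⟫ 0 / l) 0) ∂P) / ENNReal.ofReal l⁻¹ ≤
      wassersteinDist Q P :=
    le_iInf fun π => le_iInf fun h1 => le_iInf fun h2 =>
      ENNReal.div_le_of_le_mul' (tsub_le_iff_right.2 (hcoup π h1 h2))
  have := hdiv.trans hQ
  rw [ENNReal.div_le_iff' hc0 ENNReal.ofReal_ne_top, ← ENNReal.ofReal_mul (by positivity),
    ← div_eq_inv_mul, tsub_le_iff_right] at this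
  exact this

/-- Moving the fraction `w x` of the mass at `x` onto the halfspace, at total cost at most `δ`,
bounds the worst-case probability from below. -/
lemma le_supProb {d : ℕ} (P : Measure (Ed d)) [IsProbabilityMeasure P]
    (δ : ℝ) (z u : Ed d) (hu : ‖u‖ = 1) (w : Ed d → ℝ) (hw : Measurable w)
    (hw0 : ∀ x, 0 ≤ w x) (hw1 : ∀ x, w x ≤ 1)
    (hcost : ∫⁻ x, ENNReal.ofReal (w x * max ⟪u, z - x⟫ 0) ∂P ≤ ENNReal.ofReal δ) :
    ∫ x, w x ∂P ≤ supProb δ P {x | 0 ≤ ⟪u, x - z⟫} := by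
  have hT := measurable_shiftOnto z u
  have hwe : Measurable fun x => ENNReal.ofReal (w x) := hw.ennreal_ofReal
  have hwe' : Measurable fun x => ENNReal.ofReal (1 - w x) :=
    (measurable_const.sub hw).ennreal_ofReal
  have hA := measurableSet_halfspace z u
  set μ₁ := P.withDensity fun x => ENNReal.ofReal (w x) with hμ₁
  set μ₂ := P.withDensity fun x => ENNReal.ofReal (1 - w x) with hμ₂
  have hsum : μ₁ + μ₂ = P := by
    rw [hμ₁, hμ₂, ← withDensity_add_left hwe]
    conv_rhs => rw [← withDensity_one (μ := P)]
    congr 1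
    ext x
    simp [← ENNReal.ofReal_add (hw0 x) (sub_nonneg.2 (hw1 x))]
  have hm1 : Measurable fun x => (shiftOnto z u x, x) := hT.prodMk measurable_id
  have hm2 : Measurable fun x : Ed d => (x, x) := measurable_id.prodMk measurable_id
  set π := μ₁.map (fun x => (shiftOnto z u x, x)) + μ₂.map (fun x => (x, x)) with hπ
  have hfst : π.map Prod.fst = μ₁.map (shiftOnto z u) + μ₂ := by
    rw [hπ, Measure.map_add _ _ measurable_fst, Measure.map_map measurable_fst hm1,
      Measure.map_map measurable_fst hm2]
    congr 1
    exact Measure.map_id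
  have hsnd : π.map Prod.snd = P := by
    rw [hπ, Measure.map_add _ _ measurable_snd, Measure.map_map measurable_snd hm1,
      Measure.map_map measurable_snd hm2]
    refine Eq.trans ?_ hsum
    congr 1 <;> exact Measure.map_id
  have hprob : IsProbabilityMeasure (π.map Prod.fst) := by
    constructor
    rw [hfst, Measure.add_apply, Measure.map_apply hT .univ, Set.preimage_univ,
      ← Measure.add_apply, hsum, measure_univ]
  have hW : wassersteinDist (π.map Prod.fst) P ≤ ENNReal.ofReal δ := by
    refine (iInf_le_of_le π (iInf_le_of_le rfl (iInf_le_of_le hsnd le_rfl))).trans ?_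
    refine le_trans (le_of_eq ?_) hcost
    rw [hπ, lintegral_add_measure, lintegral_map (by fun_prop) hm1,
      lintegral_map (by fun_prop) hm2]
    simp only [sub_self, norm_zero, ENNReal.ofReal_zero, lintegral_zero, add_zero,
      norm_shiftOnto_sub z u _ hu]
    rw [hμ₁, lintegral_withDensity_eq_lintegral_mul _ hwe
      ((measurable_slack z u).max measurable_const).ennreal_ofReal]
    refine lintegral_congr fun x => ?_
    simp [ENNReal.ofReal_mul (hw0 x)]
  have hle : ∫ x, w x ∂P ≤ ((π.map Prod.fst) {x | 0 ≤ ⟪u, x - z⟫}).toReal := by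
    rw [integral_eq_lintegral_of_nonneg_ae (.of_forall hw0) hw.aestronglyMeasurable]
    refine ENNReal.toReal_mono (measure_ne_top _ _) ?_
    rw [hfst, Measure.add_apply, Measure.map_apply hT hA]
    have : shiftOnto z u ⁻¹' {x | 0 ≤ ⟪u, x - z⟫} = Set.univ :=
      Set.eq_univ_of_forall fun x => shiftOnto_mem z u x hu
    rw [this, hμ₁, withDensity_apply _ .univ, Measure.restrict_univ]
    exact le_self_add
  refine hle.trans (le_csSup ⟨1, ?_⟩ ⟨_, hprob, hW, rfl⟩)
  rintro v ⟨Q, hQ, -, rfl⟩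
  exact measureReal_le_one

lemma norm_indicator_id_le {s : Set ℝ} {c t : ℝ} (hs : s ⊆ Set.Icc 0 c) (hc : 0 ≤ c) :
    ‖s.indicator id t‖ ≤ c := by
  by_cases ht : t ∈ s
  · rw [Set.indicator_of_mem ht, id, Real.norm_of_nonneg (hs ht).1]
    exact (hs ht).2
  · rwa [Set.indicator_of_notMem ht, norm_zero]

lemma measurable_indicator_id {s : Set ℝ} (hs : MeasurableSet s) :
    Measurable (s.indicator (id : ℝ → ℝ)) := measurable_id.indicator hs

lemma indicator_Ioc_id_mono {a b : ℝ} (hab : a ≤ b) (t : ℝ) :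
    (Set.Ioc 0 a).indicator id t ≤ (Set.Ioc 0 b).indicator id t := by
  by_cases ht : t ∈ Set.Ioc 0 a
  · rw [Set.indicator_of_mem ht, Set.indicator_of_mem (Set.Ioc_subset_Ioc_right hab ht)]
  · rw [Set.indicator_of_notMem ht]
    exact Set.indicator_nonneg (fun t ht => ht.1.le) _

section TruncatedExpectation

variable {Ω : Type*} [MeasurableSpace Ω] {P : Measure Ω} [IsProbabilityMeasure P] {Y : Ω → ℝ}

lemma integrable_indicator_id (hY : Measurable Y) {s : Set ℝ} (hs : MeasurableSet s) {c : ℝ}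
    (hsc : s ⊆ Set.Icc 0 c) (hc : 0 ≤ c) : Integrable (fun x => s.indicator id (Y x)) P :=
  Integrable.of_bound ((measurable_indicator_id hs).comp hY).aestronglyMeasurable c
    (.of_forall fun _ => norm_indicator_id_le hsc hc)

lemma Ioc_subset_Icc_max (y : ℝ) : Set.Ioc 0 y ⊆ Set.Icc 0 (max y 0) :=
  fun _ ht => ⟨ht.1.le, ht.2.trans (le_max_left _ _)⟩

lemma monotone_truncatedExpectation (hY : Measurable Y) :
    Monotone fun y => ∫ x, (Set.Ioc (0:ℝ) y).indicator id (Y x) ∂P := by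
  intro a b hab
  refine integral_mono
    (integrable_indicator_id hY measurableSet_Ioc (Ioc_subset_Icc_max a) (le_max_right _ _))
    (integrable_indicator_id hY measurableSet_Ioc (Ioc_subset_Icc_max b) (le_max_right _ _))
    fun x => ?_
  exact indicator_Ioc_id_mono hab _

lemma tendsto_truncatedExpectation_right (hY : Measurable Y) {l : ℝ} (hl : 0 < l) :
    Filter.Tendsto (fun y => ∫ x, (Set.Ioc (0:ℝ) y).indicator id (Y x) ∂P) (nhdsWithin l (Set.Ioi l))
      (nhds (∫ x, (Set.Ioc (0:ℝ) l).indicator id (Y x) ∂P)) := by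
  refine tendsto_integral_filter_of_dominated_convergence (fun _ => l + 1)
    (.of_forall fun y => ((measurable_indicator_id measurableSet_Ioc).comp hY).aestronglyMeasurable)
    ?_ (integrable_const _) (.of_forall fun x => ?_)
  · filter_upwards [Ioo_mem_nhdsGT (show l < l + 1 by linarith)] with y hy
    exact .of_forall fun x => norm_indicator_id_le
      (fun t ht => ⟨ht.1.le, ht.2.trans hy.2.le⟩) (by linarith)
  · refine tendsto_const_nhds.congr' ?_
    rcases le_or_gt (Y x) l with h | h
    · filter_upwards [self_mem_nhdsWithin] with y (hy : l < y)
      simp [Set.indicator_apply, h, h.trans hy.le]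
    · filter_upwards [Ioo_mem_nhdsGT h] with y hy
      simp [h.not_ge, hy.2.not_ge]

lemma tendsto_truncatedExpectation_left (hY : Measurable Y) {l : ℝ} (hl : 0 < l) :
    Filter.Tendsto (fun y => ∫ x, (Set.Ioc (0:ℝ) y).indicator id (Y x) ∂P) (nhdsWithin l (Set.Iio l))
      (nhds (∫ x, (Set.Ioo (0:ℝ) l).indicator id (Y x) ∂P)) := by
  refine tendsto_integral_filter_of_dominated_convergence (fun _ => l)
    (.of_forall fun y => ((measurable_indicator_id measurableSet_Ioc).comp hY).aestronglyMeasurable)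
    ?_ (integrable_const _) (.of_forall fun x => ?_)
  · filter_upwards [self_mem_nhdsWithin] with y (hy : y < l)
    exact .of_forall fun x => norm_indicator_id_le
      (fun t ht => ⟨ht.1.le, ht.2.trans hy.le⟩) hl.le
  · refine tendsto_const_nhds.congr' ?_
    rcases lt_or_ge (Y x) l with h | h
    · filter_upwards [Ioo_mem_nhdsLT h] with y hy
      simp [Set.indicator_apply, h, hy.1.le]
    · filter_upwards [self_mem_nhdsWithin] with y (hy : y < l)
      simp [h.not_gt, (hy.trans_le h).not_ge]

lemma integral_one_sub_pos_part_div (hY : Measurable Y) {l : ℝ} (hl : 0 < l) :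
    ∫ x, max (1 - max (Y x) 0 / l) 0 ∂P =
      (P {x | Y x ≤ l}).toReal - (∫ x, (Set.Ioc (0:ℝ) l).indicator id (Y x) ∂P) / l := by
  have hm : MeasurableSet {x | Y x ≤ l} := measurableSet_le hY measurable_const
  have hi : Integrable ({x | Y x ≤ l}.indicator (1 : Ω → ℝ)) P :=
    (integrable_const (1 : ℝ)).indicator hm
  rw [← measureReal_def, ← integral_indicator_one hm, ← integral_div, ← integral_sub hi
    ((integrable_indicator_id hY measurableSet_Ioc Set.Ioc_subset_Icc_self hl.le).div_const l)]
  refine integral_congr_ae (.of_forall fun x => ?_)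
  simp only [Set.indicator_apply, Set.mem_ofPred_eq, Set.mem_Ioc, id, Pi.one_apply]
  rcases le_or_gt (Y x) 0 with h0 | h0
  · simp [h0, h0.not_gt, h0.trans hl.le]
  · rcases le_or_gt (Y x) l with h1 | h1
    · have : Y x / l ≤ 1 := (div_le_one hl).2 h1
      simp [h0, h1, h0.le, this]
    · have : 1 ≤ Y x / l := (one_le_div hl).2 h1.le
      simp [h0.le, h1.not_ge, this]

lemma integral_Ioc_indicator_eq_add (hY : Measurable Y) {l : ℝ} (hl : 0 < l) :
    ∫ x, (Set.Ioc (0:ℝ) l).indicator id (Y x) ∂P =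
      ∫ x, (Set.Ioo (0:ℝ) l).indicator id (Y x) ∂P + l * (P {x | Y x = l}).toReal := by
  have hm : MeasurableSet {x | Y x = l} := measurableSet_eq_fun hY measurable_const
  have hi : Integrable ({x | Y x = l}.indicator (1 : Ω → ℝ)) P :=
    (integrable_const (1 : ℝ)).indicator hm
  rw [← measureReal_def, ← integral_indicator_one hm, ← integral_const_mul, ← integral_add
    (integrable_indicator_id hY measurableSet_Ioo Set.Ioo_subset_Icc_self hl.le) (hi.const_mul l)]
  refine integral_congr_ae (.of_forall fun x => ?_)
  simp only [Set.indicator_apply, Set.mem_ofPred_eq, Set.mem_Ioc, Set.mem_Ioo, id, Pi.one_apply]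
  rcases lt_trichotomy (Y x) l with h1 | h1 | h1
  · simp [h1, h1.le, h1.ne]
  · simp [h1, hl]
  · simp [h1.not_ge, h1.not_gt, h1.ne']

lemma toReal_measure_le_eq_add (hY : Measurable Y) (l : ℝ) :
    (P {x | Y x ≤ l}).toReal = (P {x | Y x < l}).toReal + (P {x | Y x = l}).toReal := by
  have hd : Disjoint {x | Y x < l} {x | Y x = l} :=
    Set.disjoint_left.2 fun x (h1 : Y x < l) h2 => h1.ne h2
  rw [← ENNReal.toReal_add (measure_ne_top _ _) (measure_ne_top _ _),
    ← measure_union hd (measurableSet_eq_fun hY measurable_const)]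
  congr 2
  ext x
  exact le_iff_lt_or_eq (a := Y x) (b := l)

/-- If all truncated expectations stay below `δ`, so does the mean of the positive part. -/
lemma lintegral_pos_part_le (hY : Measurable Y) {δ : ℝ}
    (h : ∀ y, 0 ≤ y → ∫ x, (Set.Ioc (0:ℝ) y).indicator id (Y x) ∂P ≤ δ) :
    ∫⁻ x, ENNReal.ofReal (max (Y x) 0) ∂P ≤ ENNReal.ofReal δ := by
  have hsup : ∀ x, Filter.Tendsto
      (fun n : ℕ => ENNReal.ofReal ((Set.Ioc (0:ℝ) n).indicator id (Y x))) Filter.atTop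
      (nhds (ENNReal.ofReal (max (Y x) 0))) := by
    intro x
    refine tendsto_const_nhds.congr' ?_
    obtain ⟨N, hN⟩ := exists_nat_ge (Y x)
    filter_upwards [Filter.eventually_ge_atTop N] with n hn
    have : Y x ≤ n := hN.trans (by exact_mod_cast hn)
    rcases le_or_gt (Y x) 0 with h0 | h0
    · simp [h0, h0.not_gt]
    · simp [h0, this, h0.le]
  have hlim := lintegral_tendsto_of_tendsto_of_monotone (μ := P)
    (fun n => (((measurable_indicator_id measurableSet_Ioc).comp hY).ennreal_ofReal).aemeasurable)
    (.of_forall fun x m n hmn => ENNReal.ofReal_le_ofReal ?_) (.of_forall hsup)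
  · refine le_of_tendsto' hlim fun n => ?_
    simp only [Function.comp_apply]
    rw [← ofReal_integral_eq_lintegral_ofReal
      (integrable_indicator_id hY measurableSet_Ioc Set.Ioc_subset_Icc_self n.cast_nonneg)
      (.of_forall fun x => Set.indicator_nonneg (fun t ht => ht.1.le) _)]
    exact ENNReal.ofReal_le_ofReal (h n n.cast_nonneg)
  · have hmn' : (m : ℝ) ≤ n := by exact_mod_cast hmn
    exact indicator_Ioc_id_mono hmn' _

end TruncatedExpectation

/-- **The inner problem.** For `0 < δ < ∞`, `‖u‖ = 1` and `Y = ⟪u, z - X⟫`, the worst-case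
probability of the halfspace `{x : ⟪u, x - z⟫ ≥ 0}` over the Wasserstein ball of radius `δ`
equals `inf_{λ' > 0} {δ/λ' + E (1 - Y⁺/λ')⁺}`; the infimum is attained at `λ = h⁻¹(δ)`
(the value being `1` when `λ = ∞`, i.e. when `{y ≥ 0 : h y ≥ δ}` is empty), and for finite `λ`
the value also equals `P(Y ≤ λ) - (h(λ) - δ)/λ` and `P(Y < λ) + (δ - h(λ-))/λ`. -/
theorem inner_problem_sup {d : ℕ} (P : Measure (Ed d)) [IsProbabilityMeasure P]
    (δ : ℝ) (hδ : 0 < δ) (z u : Ed d) (hu : ‖u‖ = 1)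
    (Y : Ed d → ℝ) (hY : Y = fun x => ⟪u, z - x⟫)
    (h : ℝ → ℝ) (hh : h = fun y => ∫ x, (Set.Ioc (0:ℝ) y).indicator id (Y x) ∂P)
    (V : ℝ) (hV : V = supProb δ P {x | 0 ≤ ⟪u, x - z⟫})
    (S : Set ℝ) (hS : S = {y : ℝ | 0 ≤ y ∧ δ ≤ h y}) :
    V = sInf {v : ℝ | ∃ l : ℝ, 0 < l ∧
        v = δ / l + ∫ x, max (1 - max (Y x) 0 / l) 0 ∂P} ∧
    (S = ∅ → V = 1) ∧
    (S.Nonempty →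
      0 < sInf S ∧
      V = δ / sInf S + ∫ x, max (1 - max (Y x) 0 / sInf S) 0 ∂P ∧
      V = (P {x | Y x ≤ sInf S}).toReal - (h (sInf S) - δ) / sInf S ∧
      V = (P {x | Y x < sInf S}).toReal + (δ - Function.leftLim h (sInf S)) / sInf S) := by
  have hmY : Measurable Y := hY ▸ measurable_slack z u
  set G : ℝ → ℝ := fun l => δ / l + ∫ x, max (1 - max (Y x) 0 / l) 0 ∂P with hG
  have hset : {v : ℝ | ∃ l : ℝ, 0 < l ∧ v = δ / l + ∫ x, max (1 - max (Y x) 0 / l) 0 ∂P} =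
      G '' Set.Ioi 0 := by
    ext v
    simp only [hG, Set.mem_ofPred_eq, Set.mem_image, Set.mem_Ioi, eq_comm]
  have hVG : ∀ l, 0 < l → V ≤ G l := by
    intro l hl
    rw [hV]
    have hG0 : 0 ≤ G l :=
      add_nonneg (by positivity) (integral_nonneg fun x => le_max_right _ _)
    refine Real.sSup_le ?_ hG0
    rintro v ⟨Q, -, hQ, rfl⟩
    have := measure_halfspace_le P Q hδ z u hu hQ hl
    simpa only [hG, hY] using this
  have hinf : ∀ c ∈ lowerBounds (G '' Set.Ioi 0), c ≤ sInf (G '' Set.Ioi 0) := fun c hc =>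
    le_csInf ⟨_, Set.mem_image_of_mem G (Set.mem_Ioi.2 one_pos)⟩ hc
  have hVlb : V ∈ lowerBounds (G '' Set.Ioi 0) := by
    rintro _ ⟨l, hl, rfl⟩
    exact hVG l hl
  have hmono : Monotone h := hh ▸ monotone_truncatedExpectation hmY
  rw [hset]
  rcases S.eq_empty_or_nonempty with hSe | hSn
  · have hV1 : V = 1 := by
      apply le_antisymm
      · rw [hV]
        refine Real.sSup_le ?_ zero_le_one
        rintro v ⟨Q, hQ, -, rfl⟩
        exact measureReal_le_one
      · have := le_supProb P δ z u hu (fun _ => 1) measurable_const (fun _ => zero_le_one)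
          (fun _ => le_rfl) ?_
        · simpa [hV] using this
        · simp only [one_mul]
          have := lintegral_pos_part_le (P := P) hmY (δ := δ) fun y hy => ?_
          · simpa only [hY] using this
          · by_contra! hc
            have : y ∈ S := by rw [hS, hh]; exact ⟨hy, hc.le⟩
            rw [hSe] at this
            exact this
    refine ⟨le_antisymm (hinf V hVlb) ?_, fun _ => hV1, fun hne => absurd hSe hne.ne_empty⟩
    have hlim : Filter.Tendsto (fun l : ℝ => δ / l + 1) Filter.atTop (nhds V) := by
      have := (tendsto_const_nhds (x := δ)).div_atTop (Filter.tendsto_id (α := ℝ))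
      simpa [hV1] using this.add_const 1
    refine ge_of_tendsto hlim ?_
    filter_upwards [Filter.eventually_gt_atTop 0] with l hl
    refine (csInf_le ⟨V, hVlb⟩ ⟨l, hl, rfl⟩).trans ?_
    have hle : ∫ x, max (1 - max (Y x) 0 / l) 0 ∂P ≤ ∫ _, (1 : ℝ) ∂P := by
      refine integral_mono_of_nonneg (.of_forall fun x => le_max_right _ _)
        (integrable_const _) (.of_forall fun x => ?_)
      have : 0 ≤ max (Y x) 0 / l := by positivity
      exact max_le (by linarith) zero_le_one
    simp only [integral_const, probReal_univ, smul_eq_mul, mul_one] at hle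
    simp only [hG]
    linarith
  · set l := sInf S with hl
    have hbdd : BddBelow S := ⟨0, fun y hy => by rw [hS] at hy; exact hy.1⟩
    have hly : ∀ y, h y ≤ max y 0 := by
      intro y
      have : ∫ x, (Set.Ioc (0:ℝ) y).indicator id (Y x) ∂P ≤ ∫ _, max y 0 ∂P :=
        integral_mono (integrable_indicator_id hmY measurableSet_Ioc (Ioc_subset_Icc_max y)
          (le_max_right _ _)) (integrable_const _) fun x =>
          (le_abs_self _).trans (norm_indicator_id_le (Ioc_subset_Icc_max y) (le_max_right _ _))
      simpa [hh] using this
    have hl0 : 0 < l := by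
      refine hδ.trans_le (le_csInf hSn fun y hy => ?_)
      rw [hS] at hy
      have := hly y
      rw [max_eq_left hy.1] at this
      exact hy.2.trans this
    have hright : δ ≤ h l := by
      have := tendsto_truncatedExpectation_right (P := P) hmY hl0
      rw [hh]
      refine ge_of_tendsto this ?_
      filter_upwards [self_mem_nhdsWithin] with y (hy : l < y)
      obtain ⟨s, hs, hsy⟩ := exists_lt_of_csInf_lt hSn hy
      rw [hS] at hs
      have := hs.2.trans (hmono hsy.le)
      rwa [hh] at this
    set h₀ := ∫ x, (Set.Ioo (0:ℝ) l).indicator id (Y x) ∂P with hh0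
    have htl := tendsto_truncatedExpectation_left (P := P) hmY hl0
    have hleft : h₀ ≤ δ := by
      refine le_of_tendsto htl ?_
      filter_upwards [Ioo_mem_nhdsLT hl0] with y hy
      by_contra! hc
      have : y ∈ S := by rw [hS, hh]; exact ⟨hy.1.le, hc.le⟩
      exact notMem_of_lt_csInf hy.2 hbdd this
    have hleftLim : Function.leftLim h l = h₀ := by
      refine tendsto_nhds_unique (hmono.tendsto_leftLim l) ?_
      rw [hh]
      exact htl
    set p := (P {x | Y x = l}).toReal with hp
    have hp0 : 0 ≤ p := ENNReal.toReal_nonneg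
    have hsplit : h l = h₀ + l * p := by
      rw [hh]
      exact integral_Ioc_indicator_eq_add hmY hl0
    have hPle : (P {x | Y x ≤ l}).toReal = (P {x | Y x < l}).toReal + p :=
      toReal_measure_le_eq_add hmY l
    have hG1 : G l = (P {x | Y x ≤ l}).toReal - (h l - δ) / l := by
      simp only [hG, hh]
      rw [integral_one_sub_pos_part_div hmY hl0]
      ring
    have hG2 : G l = (P {x | Y x < l}).toReal + (δ - h₀) / l := by
      rw [hG1, hPle, hsplit]
      field_simp
      ring
    obtain ⟨t, ht0, ht1, htp⟩ : ∃ t : ℝ, 0 ≤ t ∧ t ≤ 1 ∧ t * (l * p) = δ - h₀ := by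
      rcases hp0.eq_or_lt with h0 | h0
      · refine ⟨0, le_rfl, zero_le_one, ?_⟩
        rw [← h0] at hsplit
        linarith
      · have hlp : 0 < l * p := mul_pos hl0 h0
        exact ⟨(δ - h₀) / (l * p), div_nonneg (by linarith) hlp.le,
          (div_le_one hlp).2 (by linarith), div_mul_cancel₀ _ hlp.ne'⟩
    have hmlt : MeasurableSet {x | Y x < l} := measurableSet_lt hmY measurable_const
    have hmeq : MeasurableSet {x | Y x = l} := measurableSet_eq_fun hmY measurable_const
    have hilt : Integrable ({x | Y x < l}.indicator (1 : Ed d → ℝ)) P :=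
      (integrable_const (1 : ℝ)).indicator hmlt
    have hieq : Integrable ({x | Y x = l}.indicator (1 : Ed d → ℝ)) P :=
      (integrable_const (1 : ℝ)).indicator hmeq
    set w : Ed d → ℝ := fun x =>
      {x | Y x < l}.indicator 1 x + t * {x | Y x = l}.indicator 1 x with hw
    have hwcases : ∀ x, 0 ≤ w x ∧ w x ≤ 1 ∧ w x * max (Y x) 0 =
        (Set.Ioo (0:ℝ) l).indicator id (Y x) + t * l * {x | Y x = l}.indicator 1 x := by
      intro x
      simp only [hw, Set.indicator_apply, Set.mem_ofPred_eq, Set.mem_Ioo, id, Pi.one_apply]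
      rcases lt_trichotomy (Y x) l with h1 | h1 | h1
      · rcases le_or_gt (Y x) 0 with h2 | h2
        · simp [h1, h1.ne, h2, h2.not_gt]
        · simp [h1, h1.ne, h2, h2.le]
      · simp [h1, ht0, ht1, hl0.le]
      · simp [h1.not_gt, h1.ne']
    have hint : ∫ x, w x ∂P = G l := by
      simp only [hw]
      rw [integral_add hilt (hieq.const_mul t), integral_const_mul, integral_indicator_one hmlt,
        integral_indicator_one hmeq, hG2, measureReal_def, measureReal_def, ← hp, ← htp]
      field_simp
    have hcost : ∫ x, w x * max (Y x) 0 ∂P = δ := by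
      simp only [fun x => (hwcases x).2.2]
      rw [integral_add (integrable_indicator_id hmY measurableSet_Ioo Set.Ioo_subset_Icc_self
        hl0.le) (hieq.const_mul _), integral_const_mul, integral_indicator_one hmeq,
        measureReal_def, ← hp, ← hh0]
      linarith
    have hintc : Integrable (fun x => w x * max (Y x) 0) P := by
      simp only [fun x => (hwcases x).2.2]
      exact (integrable_indicator_id hmY measurableSet_Ioo Set.Ioo_subset_Icc_self
        hl0.le).add (hieq.const_mul _)
    have hwm : Measurable w :=
      (measurable_one.indicator hmlt).add ((measurable_one.indicator hmeq).const_mul t)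
    have hGV : G l ≤ V := by
      rw [hV, ← hint]
      refine le_supProb P δ z u hu w hwm (fun x => (hwcases x).1) (fun x => (hwcases x).2.1) ?_
      rw [← hcost, ofReal_integral_eq_lintegral_ofReal hintc
        (.of_forall fun x => mul_nonneg (hwcases x).1 (le_max_right _ _)), hY]
    have hVeq : V = G l := le_antisymm (hVG l hl0) hGV
    refine ⟨le_antisymm (hinf V hVlb) ((csInf_le ⟨V, hVlb⟩ ⟨l, hl0, rfl⟩).trans hGV),
      fun hSe => absurd hSe hSn.ne_empty, fun _ => ⟨hl0, hVeq, hVeq.trans hG1, ?_⟩⟩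
    rw [hleftLim]
    exact hVeq.trans hG2
end

section
/- Let Y_1, Y_2 be real random variables such that Y_1⁺ is stochastically smaller than Y_2⁺, i.e. P(Y_1⁺ ≤ y) ≥ P(Y_2⁺ ≤ y) for all y ∈ ℝ. Then for every δ ≥ 0, v_1(δ) ≥ v_2(δ), where v_i(δ) is the optimal value of the one-dimensional robust problem for Y_i. -/
open MeasureTheory
open scoped ENNReal

/-- 1-Wasserstein distance between Borel measures on `ℝ`, with cost `|x - y|`. -/
noncomputable def wasserstein1 (μ ν : Measure ℝ) : ℝ≥0∞ :=
  ⨅ (π : Measure (ℝ × ℝ)) (_ : π.map Prod.fst = μ) (_ : π.map Prod.snd = ν),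
    ∫⁻ p, ENNReal.ofReal |p.1 - p.2| ∂π

/-- Optimal value of the one-dimensional robust problem for a law `μ` on `ℝ`:
`v(δ) = sup_{d_W¹(ν,μ) ≤ δ} ν((-∞,0])` for `δ > 0`, and `v(0) = μ((-∞,0])`. -/
noncomputable def robustVal (μ : Measure ℝ) (δ : ℝ) : ℝ :=
  if δ = 0 then (μ (Set.Iic 0)).toReal
  else sSup {v : ℝ | ∃ ν : Measure ℝ, IsProbabilityMeasure ν ∧
    wasserstein1 ν μ ≤ ENNReal.ofReal δ ∧ v = (ν (Set.Iic 0)).toReal}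

/-- A quantile of order `p ∈ (0, 1)` of a probability measure on `ℝ`. -/
theorem exists_measure_Iio_le_le_measure_Iic (m : Measure ℝ) [IsProbabilityMeasure m] {p : ℝ}
    (hp0 : 0 < p) (hp1 : p < 1) :
    ∃ q : ℝ, m (Set.Iio q) ≤ ENNReal.ofReal p ∧ ENNReal.ofReal p ≤ m (Set.Iic q) := by
  set S : Set ℝ := {x | p ≤ ProbabilityTheory.cdf m x} with hS
  have hne : S.Nonempty :=
    ((ProbabilityTheory.tendsto_cdf_atTop m).eventually (eventually_ge_nhds hp1)).exists
  obtain ⟨a, ha⟩ :=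
    ((ProbabilityTheory.tendsto_cdf_atBot m).eventually (eventually_lt_nhds hp0)).exists
  have hbdd : BddBelow S := by
    refine ⟨a, fun x hx => ?_⟩
    by_contra! hxa
    exact absurd (hx.trans (ProbabilityTheory.monotone_cdf m hxa.le)) (not_le.2 ha)
  refine ⟨sInf S, ?_, ?_⟩
  · have h := StieltjesFunction.measure_Iio (ProbabilityTheory.cdf m)
      (ProbabilityTheory.tendsto_cdf_atBot m) (sInf S)
    rw [ProbabilityTheory.measure_cdf, sub_zero] at h
    rw [h]
    refine ENNReal.ofReal_le_ofReal ?_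
    refine le_of_tendsto ((ProbabilityTheory.monotone_cdf m).tendsto_leftLim (sInf S)) ?_
    filter_upwards [self_mem_nhdsWithin] with x hx
    by_contra! hpx
    exact absurd (csInf_le hbdd (show x ∈ S from hpx.le)) (not_le.2 hx)
  · have h := ProbabilityTheory.ofReal_cdf m (sInf S)
    rw [← h]
    refine ENNReal.ofReal_le_ofReal ?_
    have hr := ((ProbabilityTheory.cdf m).right_continuous (sInf S)).mono_left
      (nhdsWithin_mono _ Set.Ioi_subset_Ici_self)
    refine ge_of_tendsto hr ?_
    filter_upwards [self_mem_nhdsWithin] with x hx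
    obtain ⟨y, hy, hyx⟩ := exists_lt_of_csInf_lt hne hx
    exact le_trans hy (ProbabilityTheory.monotone_cdf m hyx.le)

/-- A randomised threshold test in `T` with prescribed level `p ∈ (0, 1)`. -/
theorem exists_threshold_test {α : Type*} [MeasurableSpace α] (m : Measure α)
    [IsProbabilityMeasure m] {T : α → ℝ} (hT : Measurable T) {p : ℝ}
    (hp0 : 0 < p) (hp1 : p < 1) :
    ∃ (q : ℝ) (g : α → ℝ≥0∞), Measurable g ∧ (∀ a, g a ≤ 1) ∧ (∀ a, T a < q → g a = 1) ∧
      (∀ a, q < T a → g a = 0) ∧ ∫⁻ a, g a ∂m = ENNReal.ofReal p := by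
  have : IsProbabilityMeasure (m.map T) := Measure.isProbabilityMeasure_map hT.aemeasurable
  obtain ⟨q, hq1, hq2⟩ := exists_measure_Iio_le_le_measure_Iic (m.map T) hp0 hp1
  rw [Measure.map_apply hT measurableSet_Iio] at hq1
  rw [Measure.map_apply hT measurableSet_Iic] at hq2
  have hA : MeasurableSet (T ⁻¹' Set.Iio q) := hT measurableSet_Iio
  have hB : MeasurableSet (T ⁻¹' {q}) := hT (measurableSet_singleton q)
  have hle : ENNReal.ofReal p ≤ m (T ⁻¹' Set.Iio q) + m (T ⁻¹' {q}) := by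
    refine hq2.trans ((measure_mono ?_).trans (measure_union_le _ _))
    intro a ha
    exact lt_or_eq_of_le (show T a ≤ q from ha)
  have hdiff : ENNReal.ofReal p - m (T ⁻¹' Set.Iio q) ≤ m (T ⁻¹' {q}) :=
    tsub_le_iff_left.2 hle
  set c : ℝ≥0∞ := (ENNReal.ofReal p - m (T ⁻¹' Set.Iio q)) / m (T ⁻¹' {q}) with hc
  have hc1 : c ≤ 1 := ENNReal.div_le_of_le_mul (by simpa using hdiff)
  have hcB : c * m (T ⁻¹' {q}) = ENNReal.ofReal p - m (T ⁻¹' Set.Iio q) := by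
    refine ENNReal.div_mul_cancel' (fun h0 => ?_) (fun h => absurd h (measure_ne_top _ _))
    simpa [h0] using hdiff
  refine ⟨q, fun a => (T ⁻¹' Set.Iio q).indicator (fun _ => 1) a +
    (T ⁻¹' {q}).indicator (fun _ => c) a, ?_, fun a => ?_, fun a ha => ?_, fun a ha => ?_, ?_⟩
  · exact (measurable_const.indicator hA).add (measurable_const.indicator hB)
  · rcases lt_trichotomy (T a) q with h | h | h
    · simp [Set.indicator, h, h.ne]
    · simp [Set.indicator, h, hc1]
    · simp [Set.indicator, h.not_gt, h.ne']
  · simp [Set.indicator, ha, ha.ne]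
  · simp [Set.indicator, ha.not_gt, ha.ne']
  · rw [lintegral_add_left (measurable_const.indicator hA), lintegral_indicator_const hA,
      lintegral_indicator_const hB, hcB, one_mul, add_tsub_cancel_of_le hq1]

/-- Expected shortfalls `E(q - Z)⁺` are antitone in `Z` for the usual stochastic order. -/
theorem lintegral_ofReal_sub_le_of_stochastic_le {Ω : Type*} [MeasurableSpace Ω] (μ : Measure Ω)
    {Z₁ Z₂ : Ω → ℝ} (h₁ : Measurable Z₁) (h₂ : Measurable Z₂)
    (hord : ∀ y : ℝ, μ {ω | Z₂ ω ≤ y} ≤ μ {ω | Z₁ ω ≤ y}) (q : ℝ) :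
    ∫⁻ ω, ENNReal.ofReal (q - Z₂ ω) ∂μ ≤ ∫⁻ ω, ENNReal.ofReal (q - Z₁ ω) ∂μ := by
  have key : ∀ Z : Ω → ℝ, Measurable Z → ∫⁻ ω, ENNReal.ofReal (q - Z ω) ∂μ =
      ∫⁻ t in Set.Ioi (0 : ℝ), μ {ω | Z ω ≤ q - t} := by
    intro Z hZ
    have h := lintegral_eq_lintegral_meas_le μ (f := fun ω => max (q - Z ω) 0)
      (Filter.Eventually.of_forall fun ω => le_max_right _ _)
      (((measurable_const.sub hZ).max measurable_const).aemeasurable)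
    simp only [ENNReal.ofReal_max, ENNReal.ofReal_zero, zero_le, max_eq_left] at h
    refine h.trans (setLIntegral_congr_fun measurableSet_Ioi fun t ht => ?_)
    have ht' : (0 : ℝ) < t := ht
    congr 1
    ext ω
    simp only [Set.mem_ofPred_eq, le_max_iff, not_le.2 ht', or_false]
    exact le_sub_comm
  rw [key Z₁ h₁, key Z₂ h₂]
  exact lintegral_mono fun t => hord _

/-- Every coupling of `ν` and `μ` pays at least for bringing the mass `ν((-∞, 0])` back to `0`. -/
theorem mul_measure_Iic_le_cost_add_lintegral (π : Measure (ℝ × ℝ)) (q : ℝ) {s : ℝ≥0∞}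
    (hs : s ≤ 1) :
    ENNReal.ofReal q * (s * π.map Prod.fst (Set.Iic 0)) ≤
      s * ∫⁻ z, ENNReal.ofReal |z.1 - z.2| ∂π +
        ∫⁻ y, ENNReal.ofReal (q - max y 0) ∂(π.map Prod.snd) := by
  have hA : MeasurableSet (Prod.fst ⁻¹' Set.Iic (0 : ℝ) : Set (ℝ × ℝ)) :=
    measurable_fst measurableSet_Iic
  rw [Measure.map_apply measurable_fst measurableSet_Iic,
    lintegral_map (by fun_prop) measurable_snd, ← lintegral_const_mul _ (by fun_prop),
    ← lintegral_add_left (by fun_prop), ← mul_assoc, ← lintegral_indicator_const hA]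
  refine lintegral_mono fun z => ?_
  by_cases hz : z.1 ≤ 0
  · rw [Set.indicator_of_mem (by exact hz), mul_comm]
    calc s * ENNReal.ofReal q
        ≤ s * (ENNReal.ofReal |z.1 - z.2| + ENNReal.ofReal (q - max z.2 0)) := by
          gcongr
          rw [← sub_add_cancel q (max z.2 0), add_comm (q - _)]
          refine ENNReal.ofReal_add_le.trans ?_
          simp only [add_sub_cancel_left]
          gcongr
          exact max_le (by linarith [neg_abs_le (z.1 - z.2)]) (abs_nonneg _)
      _ ≤ _ := by
          rw [mul_add]
          gcongr
          exact mul_le_of_le_one_left (zero_le) hs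
  · rw [Set.indicator_of_notMem (by exact hz)]
    exact zero_le

/-- Moving the fraction `g y` of the mass at each `y` to `min y 0` costs `∫ y⁺ g(y) dμ(y)`. -/
theorem exists_wasserstein1_le_lintegral (μ : Measure ℝ) [IsProbabilityMeasure μ]
    {g : ℝ → ℝ≥0∞} (hg : Measurable g) (hg1 : ∀ y, g y ≤ 1) :
    ∃ ν : Measure ℝ, IsProbabilityMeasure ν ∧
      wasserstein1 ν μ ≤ ∫⁻ y, g y * ENNReal.ofReal (max y 0) ∂μ ∧
      ∫⁻ y, g y ∂μ ≤ ν (Set.Iic 0) := by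
  have hf : Measurable fun y : ℝ => (min y 0, y) := by fun_prop
  have hd : Measurable fun y : ℝ => (y, y) := by fun_prop
  set π : Measure (ℝ × ℝ) := (μ.withDensity g).map (fun y => (min y 0, y)) +
    (μ.withDensity (fun y => 1 - g y)).map (fun y => (y, y)) with hπ
  have hsnd : π.map Prod.snd = μ := by
    rw [hπ, Measure.map_add _ _ measurable_snd, Measure.map_map measurable_snd hf,
      Measure.map_map measurable_snd hd]
    change Measure.map id _ + Measure.map id _ = μ
    rw [Measure.map_id, Measure.map_id, ← withDensity_add_left hg]
    have : (g + fun y => 1 - g y) = 1 := by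
      ext y
      exact add_tsub_cancel_of_le (hg1 y)
    rw [this, withDensity_one]
  have hprob : IsProbabilityMeasure π := by
    refine ⟨?_⟩
    rw [← Set.preimage_univ (f := (Prod.snd : ℝ × ℝ → ℝ)),
      ← Measure.map_apply measurable_snd MeasurableSet.univ, hsnd, measure_univ]
  refine ⟨π.map Prod.fst, Measure.isProbabilityMeasure_map measurable_fst.aemeasurable, ?_, ?_⟩
  · refine (iInf_le_of_le π (iInf_le_of_le rfl (iInf_le _ hsnd))).trans ?_
    rw [hπ, lintegral_add_measure, lintegral_map (by fun_prop) hf, lintegral_map (by fun_prop) hd,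
      lintegral_withDensity_eq_lintegral_mul _ hg (by fun_prop)]
    simp only [sub_self, abs_zero, ENNReal.ofReal_zero, lintegral_zero, add_zero]
    refine lintegral_mono fun y => ?_
    simp only [Pi.mul_apply]
    gcongr
    rcases le_total y 0 with h | h
    · simp [h]
    · simp [h, abs_of_nonneg h]
  · rw [Measure.map_apply measurable_fst measurableSet_Iic, hπ, Measure.add_apply,
      Measure.map_apply hf (measurable_fst measurableSet_Iic)]
    refine le_add_right ?_
    have : (fun y : ℝ => (min y 0, y)) ⁻¹' (Prod.fst ⁻¹' Set.Iic 0) = Set.univ := by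
      ext y
      simp
    rw [this, withDensity_apply _ MeasurableSet.univ, Measure.restrict_univ]

/-- If the positive part of `μ₁` is stochastically smaller than that of `μ₂`, in the sense of
expected shortfalls, then any level below `ν((-∞, 0])` that is reached within distance `δ` of `μ₂`
is reached within distance `δ` of `μ₁`. -/
theorem exists_wasserstein1_le_of_lt (μ₁ μ₂ ν : Measure ℝ) [IsProbabilityMeasure μ₁]
    [IsProbabilityMeasure ν]
    (hshort : ∀ q : ℝ, ∫⁻ y, ENNReal.ofReal (q - max y 0) ∂μ₂ ≤
      ∫⁻ y, ENNReal.ofReal (q - max y 0) ∂μ₁)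
    {δ : ℝ} (hδ : 0 < δ) (hν : wasserstein1 ν μ₂ ≤ ENNReal.ofReal δ)
    {p : ℝ} (hp0 : 0 < p) (hp : p < (ν (Set.Iic 0)).toReal) :
    ∃ ν' : Measure ℝ, IsProbabilityMeasure ν' ∧ wasserstein1 ν' μ₁ ≤ ENNReal.ofReal δ ∧
      p ≤ (ν' (Set.Iic 0)).toReal := by
  set P : ℝ := (ν (Set.Iic 0)).toReal with hP
  have hP0 : 0 < P := hp0.trans hp
  have hP1 : P ≤ 1 := measureReal_le_one
  have hs0 : 0 < p / P := div_pos hp0 hP0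
  have hs1 : p / P < 1 := (div_lt_one hP0).2 hp
  have hlt : wasserstein1 ν μ₂ < ENNReal.ofReal (δ / (p / P)) := by
    refine hν.trans_lt ((ENNReal.ofReal_lt_ofReal_iff (div_pos hδ hs0)).2 ?_)
    rw [lt_div_iff₀ hs0]
    nlinarith
  simp only [wasserstein1, iInf_lt_iff] at hlt
  obtain ⟨π, hfst, hsnd, hcost⟩ := hlt
  obtain ⟨q, g, hg, hg1, hglt, hggt, hgint⟩ := exists_threshold_test μ₁
    (T := fun y : ℝ => max y 0) (by fun_prop) hp0 (hp.trans_le hP1)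
  obtain ⟨ν', hν', hW, hmass⟩ := exists_wasserstein1_le_lintegral μ₁ hg hg1
  refine ⟨ν', hν', hW.trans ?_, ?_⟩
  · have hfin : ∫⁻ y, ENNReal.ofReal (q - max y 0) ∂μ₁ ≠ ∞ := by
      refine ne_top_of_le_ne_top (b := ∫⁻ _, ENNReal.ofReal q ∂μ₁) (by simp) ?_
      refine lintegral_mono fun y => ENNReal.ofReal_le_ofReal ?_
      linarith [le_max_right y 0]
    refine (ENNReal.add_le_add_iff_right hfin).1 ?_
    have hpt : ∀ y : ℝ, g y * ENNReal.ofReal (max y 0) + ENNReal.ofReal (q - max y 0) =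
        ENNReal.ofReal q * g y := by
      intro y
      rcases lt_trichotomy (max y 0) q with h | h | h
      · rw [hglt y h, one_mul, mul_one, ← ENNReal.ofReal_add (le_max_right _ _) (by linarith)]
        congr 1
        ring
      · rw [h, sub_self, ENNReal.ofReal_zero, add_zero, mul_comm]
      · rw [hggt y h, zero_mul, mul_zero, zero_add, ENNReal.ofReal_eq_zero]
        linarith
    rw [← lintegral_add_left (by fun_prop), lintegral_congr hpt, lintegral_const_mul _ hg, hgint]
    have hb := mul_measure_Iic_le_cost_add_lintegral π q
      (s := ENNReal.ofReal (p / P)) (by simpa using hs1.le)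
    rw [hfst, hsnd] at hb
    have hsP : ENNReal.ofReal (p / P) * ν (Set.Iic 0) = ENNReal.ofReal p := by
      rw [← ENNReal.ofReal_toReal (measure_ne_top ν (Set.Iic 0)), ← ENNReal.ofReal_mul hs0.le,
        ← hP, div_mul_cancel₀ _ hP0.ne']
    rw [hsP] at hb
    refine hb.trans (add_le_add ?_ (hshort q))
    calc ENNReal.ofReal (p / P) * ∫⁻ z, ENNReal.ofReal |z.1 - z.2| ∂π
        ≤ ENNReal.ofReal (p / P) * ENNReal.ofReal (δ / (p / P)) := by gcongr
      _ = ENNReal.ofReal δ := by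
          rw [← ENNReal.ofReal_mul hs0.le, mul_div_cancel₀ _ hs0.ne']
  · rw [← ENNReal.ofReal_le_iff_le_toReal (measure_ne_top _ _), ← hgint]
    exact hmass

/-- **Monotonicity.** If `Y₁⁺` is stochastically smaller than `Y₂⁺`, i.e.
`P(Y₁⁺ ≤ y) ≥ P(Y₂⁺ ≤ y)` for all `y`, then `v₁(δ) ≥ v₂(δ)` for every `δ ≥ 0`. -/
theorem robustVal_monotone {Ω : Type*} [MeasurableSpace Ω] (μ : Measure Ω)
    [IsProbabilityMeasure μ] (Y₁ Y₂ : Ω → ℝ) (h₁ : Measurable Y₁) (h₂ : Measurable Y₂)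
    (hord : ∀ y : ℝ, μ {ω | max (Y₂ ω) 0 ≤ y} ≤ μ {ω | max (Y₁ ω) 0 ≤ y}) :
    ∀ δ : ℝ, 0 ≤ δ → robustVal (μ.map Y₂) δ ≤ robustVal (μ.map Y₁) δ := by
  intro δ hδ
  have hprob : IsProbabilityMeasure (μ.map Y₁) := Measure.isProbabilityMeasure_map h₁.aemeasurable
  unfold robustVal
  split_ifs with h0
  · rw [Measure.map_apply h₁ measurableSet_Iic, Measure.map_apply h₂ measurableSet_Iic]
    refine ENNReal.toReal_mono (measure_ne_top _ _) ?_
    simpa [Set.preimage] using hord 0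
  · have hδ' : 0 < δ := lt_of_le_of_ne hδ (Ne.symm h0)
    have hshort : ∀ q : ℝ, ∫⁻ y, ENNReal.ofReal (q - max y 0) ∂(μ.map Y₂) ≤
        ∫⁻ y, ENNReal.ofReal (q - max y 0) ∂(μ.map Y₁) := by
      intro q
      rw [lintegral_map (by fun_prop) h₁, lintegral_map (by fun_prop) h₂]
      exact lintegral_ofReal_sub_le_of_stochastic_le μ (h₁.max measurable_const)
        (h₂.max measurable_const) hord q
    have hnonneg : 0 ≤ sSup {v : ℝ | ∃ ν : Measure ℝ, IsProbabilityMeasure ν ∧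
        wasserstein1 ν (μ.map Y₁) ≤ ENNReal.ofReal δ ∧ v = (ν (Set.Iic 0)).toReal} := by
      refine Real.sSup_nonneg ?_
      rintro v ⟨ν, -, -, rfl⟩
      exact ENNReal.toReal_nonneg
    refine Real.sSup_le ?_ hnonneg
    rintro v ⟨ν, hν, hW, rfl⟩
    refine le_of_forall_lt fun p hp => ?_
    obtain ⟨p', hpp', hp'⟩ := exists_between hp
    refine hpp'.trans_le ?_
    rcases le_or_gt p' 0 with hp0 | hp0
    · exact hp0.trans hnonneg
    obtain ⟨ν', hν', hW', hle⟩ :=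
      exists_wasserstein1_le_of_lt (μ.map Y₁) (μ.map Y₂) ν hshort hδ' hW hp0 hp'
    refine hle.trans (le_csSup ⟨1, ?_⟩ ⟨ν', hν', hW', rfl⟩)
    rintro v ⟨ν'', hν'', -, rfl⟩
    exact measureReal_le_one
end

section
/- Let Y be a real random variable whose law is the mixture of the laws of real random variables Y_1 and Y_2 with weights p ∈ (0,1) and 1 − p. Then for every δ ≥ 0, the optimal value satisfies v(δ) = sup { p·v_1(δc_1) + (1−p)·v_2(δc_2) : c_1, c_2 ≥ 0, p c_1 + (1−p) c_2 ≤ 1 }. In particular, p·v_1(δ/p) + (1−p)·v_2(0) ≤ v(δ) ≤ p·v_1(δ/p) + (1−p)·v_2(δ/(1−p)). -/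
open MeasureTheory
open scoped ENNReal

open ProbabilityTheory

lemma wasserstein1_map_le (π : Measure (ℝ × ℝ)) :
    wasserstein1 (π.map Prod.fst) (π.map Prod.snd) ≤ ∫⁻ p, ENNReal.ofReal |p.1 - p.2| ∂π :=
  iInf_le_of_le π (iInf_le_of_le rfl (iInf_le_of_le rfl le_rfl))

lemma exists_coupling_of_wasserstein1_lt {μ ν : Measure ℝ} {K : ℝ≥0∞}
    (h : wasserstein1 μ ν < K) :
    ∃ π : Measure (ℝ × ℝ), π.map Prod.fst = μ ∧ π.map Prod.snd = ν ∧
      ∫⁻ p, ENNReal.ofReal |p.1 - p.2| ∂π < K := by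
  simpa only [wasserstein1, iInf_lt_iff, exists_prop] using h

lemma wasserstein1_self (μ : Measure ℝ) : wasserstein1 μ μ = 0 := by
  have hd : Measurable fun x : ℝ => (x, x) := by fun_prop
  have h := wasserstein1_map_le (μ.map fun x : ℝ => (x, x))
  rw [Measure.map_map measurable_fst hd, Measure.map_map measurable_snd hd,
    lintegral_map (by fun_prop) hd] at h
  simpa [Function.comp_def] using h

lemma isProbabilityMeasure_mixture (μ₁ μ₂ : Measure ℝ) [IsProbabilityMeasure μ₁]
    [IsProbabilityMeasure μ₂] {p : ℝ} (hp : p ∈ Set.Ioo (0:ℝ) 1) :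
    IsProbabilityMeasure (ENNReal.ofReal p • μ₁ + ENNReal.ofReal (1 - p) • μ₂) :=
  ⟨by simp [← ENNReal.ofReal_add hp.1.le (sub_nonneg.2 hp.2.le)]⟩

lemma toReal_mixture_apply (μ₁ μ₂ : Measure ℝ) [IsProbabilityMeasure μ₁]
    [IsProbabilityMeasure μ₂] {p : ℝ} (hp : p ∈ Set.Ioo (0:ℝ) 1) (s : Set ℝ) :
    ((ENNReal.ofReal p • μ₁ + ENNReal.ofReal (1 - p) • μ₂) s).toReal =
      p * (μ₁ s).toReal + (1 - p) * (μ₂ s).toReal := by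
  have h1 := hp.1.le
  have h2 := sub_nonneg.2 hp.2.le
  simp only [Measure.add_apply, Measure.smul_apply, smul_eq_mul]
  rw [ENNReal.toReal_add (ENNReal.mul_ne_top ENNReal.ofReal_ne_top (measure_ne_top _ _))
    (ENNReal.mul_ne_top ENNReal.ofReal_ne_top (measure_ne_top _ _)), ENNReal.toReal_mul,
    ENNReal.toReal_mul, ENNReal.toReal_ofReal h1, ENNReal.toReal_ofReal h2]

lemma wasserstein1_mixture_le {μ₁ μ₂ ν₁ ν₂ : Measure ℝ} {p a b : ℝ} (hp : p ∈ Set.Ioo (0:ℝ) 1)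
    (ha : 0 ≤ a) (hb : 0 ≤ b) (h₁ : wasserstein1 ν₁ μ₁ ≤ ENNReal.ofReal a)
    (h₂ : wasserstein1 ν₂ μ₂ ≤ ENNReal.ofReal b) :
    wasserstein1 (ENNReal.ofReal p • ν₁ + ENNReal.ofReal (1 - p) • ν₂)
      (ENNReal.ofReal p • μ₁ + ENNReal.ofReal (1 - p) • μ₂) ≤
        ENNReal.ofReal (p * a + (1 - p) * b) := by
  have hp1 := hp.1.le
  have hp2 := sub_nonneg.2 hp.2.le
  refine ENNReal.le_of_forall_pos_le_add fun ε hε _ => ?_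
  have hε' : (0:ℝ) < ε := hε
  have hlt : ∀ {x : ℝ}, 0 ≤ x → ENNReal.ofReal x < ENNReal.ofReal (x + ε) := fun {x} hx =>
    (ENNReal.ofReal_lt_ofReal_iff (by linarith)).2 (by linarith)
  obtain ⟨π₁, rfl, rfl, hc₁⟩ := exists_coupling_of_wasserstein1_lt (h₁.trans_lt (hlt ha))
  obtain ⟨π₂, rfl, rfl, hc₂⟩ := exists_coupling_of_wasserstein1_lt (h₂.trans_lt (hlt hb))
  have h := wasserstein1_map_le (ENNReal.ofReal p • π₁ + ENNReal.ofReal (1 - p) • π₂)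
  simp only [Measure.map_add _ _ measurable_fst, Measure.map_add _ _ measurable_snd,
    Measure.map_smul, lintegral_add_measure, lintegral_smul_measure, smul_eq_mul] at h
  calc _ ≤ _ := h
    _ ≤ ENNReal.ofReal p * ENNReal.ofReal (a + ε) +
        ENNReal.ofReal (1 - p) * ENNReal.ofReal (b + ε) := by gcongr
    _ = ENNReal.ofReal (p * a + (1 - p) * b) + ε := by
      rw [← ENNReal.ofReal_mul hp1, ← ENNReal.ofReal_mul hp2,
        ← ENNReal.ofReal_add (by positivity) (by positivity), ← ENNReal.ofReal_coe_nnreal,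
        ← ENNReal.ofReal_add (by positivity) hε'.le]
      congr 1
      ring

lemma robustVal_zero (μ : Measure ℝ) : robustVal μ 0 = (μ (Set.Iic 0)).toReal := by
  simp [robustVal]

lemma toReal_apply_le_robustVal {μ ν : Measure ℝ} [IsProbabilityMeasure ν] {δ : ℝ} (hδ : 0 < δ)
    (h : wasserstein1 ν μ ≤ ENNReal.ofReal δ) : (ν (Set.Iic 0)).toReal ≤ robustVal μ δ := by
  rw [robustVal, if_neg hδ.ne']
  refine le_csSup ⟨1, ?_⟩ ⟨ν, inferInstance, h, rfl⟩
  rintro _ ⟨ν', _, -, rfl⟩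
  exact measureReal_le_one

lemma robustVal_le {μ : Measure ℝ} [IsProbabilityMeasure μ] {δ K : ℝ}
    (h : ∀ ν : Measure ℝ, IsProbabilityMeasure ν → wasserstein1 ν μ ≤ ENNReal.ofReal δ →
      (ν (Set.Iic 0)).toReal ≤ K) : robustVal μ δ ≤ K := by
  have hself : wasserstein1 μ μ ≤ ENNReal.ofReal δ := by simp [wasserstein1_self]
  rw [robustVal]
  split_ifs with h0
  · exact h μ inferInstance hself
  · refine csSup_le ⟨_, μ, inferInstance, hself, rfl⟩ ?_
    rintro _ ⟨ν, hν, hW, rfl⟩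
    exact h ν hν hW

lemma robustVal_mono {μ : Measure ℝ} [IsProbabilityMeasure μ] {δ δ' : ℝ} (h0 : 0 ≤ δ)
    (h : δ ≤ δ') : robustVal μ δ ≤ robustVal μ δ' := by
  rcases h.eq_or_lt with rfl | hlt
  · rfl
  · exact robustVal_le fun ν _ hW => toReal_apply_le_robustVal (h0.trans_lt hlt)
      (hW.trans (ENNReal.ofReal_le_ofReal h))

lemma robustVal_nonneg (μ : Measure ℝ) (δ : ℝ) : 0 ≤ robustVal μ δ := by
  rw [robustVal]
  split_ifs
  · exact ENNReal.toReal_nonneg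
  · refine Real.sSup_nonneg ?_
    rintro _ ⟨ν, _, -, rfl⟩
    exact ENNReal.toReal_nonneg

lemma mixture_robustVal_le (μ₁ μ₂ : Measure ℝ) [IsProbabilityMeasure μ₁]
    [IsProbabilityMeasure μ₂] {p a b : ℝ} (hp : p ∈ Set.Ioo (0:ℝ) 1) (ha : 0 ≤ a) (hb : 0 ≤ b) :
    p * robustVal μ₁ a + (1 - p) * robustVal μ₂ b ≤
      robustVal (ENNReal.ofReal p • μ₁ + ENNReal.ofReal (1 - p) • μ₂) (p * a + (1 - p) * b) := by
  have hp1 := hp.1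
  have hp2 := sub_pos.2 hp.2
  rcases (add_nonneg (mul_nonneg hp1.le ha) (mul_nonneg hp2.le hb)).eq_or_lt with h0 | hpos
  · have ha0 : a = 0 := by
      have := mul_nonneg hp2.le hb
      have := mul_nonneg hp1.le ha
      exact (mul_eq_zero.1 (by linarith : p * a = 0)).resolve_left hp1.ne'
    have hb0 : b = 0 := by
      subst ha0
      exact (mul_eq_zero.1 (by linarith : (1 - p) * b = 0)).resolve_left hp2.ne'
    subst ha0 hb0
    simp [robustVal_zero, -Measure.coe_add, toReal_mixture_apply _ _ hp]
  · set V := robustVal (ENNReal.ofReal p • μ₁ + ENNReal.ofReal (1 - p) • μ₂)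
      (p * a + (1 - p) * b)
    have key : ∀ ν₁ : Measure ℝ, IsProbabilityMeasure ν₁ →
        wasserstein1 ν₁ μ₁ ≤ ENNReal.ofReal a → ∀ ν₂ : Measure ℝ, IsProbabilityMeasure ν₂ →
        wasserstein1 ν₂ μ₂ ≤ ENNReal.ofReal b →
        p * (ν₁ (Set.Iic 0)).toReal + (1 - p) * (ν₂ (Set.Iic 0)).toReal ≤ V := by
      intro ν₁ _ hW₁ ν₂ _ hW₂
      have := isProbabilityMeasure_mixture ν₁ ν₂ hp
      rw [← toReal_mixture_apply ν₁ ν₂ hp]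
      exact toReal_apply_le_robustVal hpos (wasserstein1_mixture_le hp ha hb hW₁ hW₂)
    have hfst : robustVal μ₁ a ≤ (V - (1 - p) * robustVal μ₂ b) / p := by
      refine robustVal_le fun ν₁ hν₁ hW₁ => ?_
      have hsnd : robustVal μ₂ b ≤ (V - p * (ν₁ (Set.Iic 0)).toReal) / (1 - p) := by
        refine robustVal_le fun ν₂ hν₂ hW₂ => ?_
        rw [le_div_iff₀ hp2]
        linarith [key ν₁ hν₁ hW₁ ν₂ hν₂ hW₂]
      rw [le_div_iff₀ hp2] at hsnd
      rw [le_div_iff₀ hp1]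
      linarith
    rw [le_div_iff₀ hp1] at hfst
    linarith

lemma mul_robustVal_le (μ : Measure ℝ) [IsProbabilityMeasure μ] {t a : ℝ}
    (ht : t ∈ Set.Ioo (0:ℝ) 1) (ha : 0 ≤ a) : t * robustVal μ a ≤ robustVal μ (t * a) := by
  have h := mixture_robustVal_le μ μ ht ha le_rfl
  rw [← add_smul, ← ENNReal.ofReal_add ht.1.le (sub_nonneg.2 ht.2.le)] at h
  simp only [add_sub_cancel, ENNReal.ofReal_one, one_smul, mul_zero, add_zero] at h
  linarith [mul_nonneg (sub_nonneg.2 ht.2.le) (robustVal_nonneg μ 0)]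

lemma map_fst_apply_le_robustVal (π : Measure (ℝ × ℝ)) [IsProbabilityMeasure π] {δ : ℝ}
    (hδ : 0 ≤ δ) (h : ∫⁻ p, ENNReal.ofReal |p.1 - p.2| ∂π ≤ ENNReal.ofReal δ) :
    ((π.map Prod.fst) (Set.Iic 0)).toReal ≤ robustVal (π.map Prod.snd) δ := by
  have : IsProbabilityMeasure (π.map Prod.fst) :=
    Measure.isProbabilityMeasure_map measurable_fst.aemeasurable
  rcases hδ.eq_or_lt with rfl | hpos
  · rw [ENNReal.ofReal_zero, nonpos_iff_eq_zero, lintegral_eq_zero_iff (by fun_prop)] at h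
    have heq : Prod.fst =ᵐ[π] Prod.snd := by
      filter_upwards [h] with x hx
      have : |x.1 - x.2| ≤ 0 := ENNReal.ofReal_eq_zero.1 hx
      exact sub_eq_zero.1 (abs_nonpos_iff.1 this)
    rw [robustVal_zero, Measure.map_congr heq]
  · exact toReal_apply_le_robustVal hpos ((wasserstein1_map_le π).trans h)

lemma exists_le_mixture_robustVal (μ₁ μ₂ : Measure ℝ) [IsProbabilityMeasure μ₁]
    [IsProbabilityMeasure μ₂] {p K : ℝ} (hp : p ∈ Set.Ioo (0:ℝ) 1) (hK : 0 ≤ K)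
    (π : Measure (ℝ × ℝ))
    (hsnd : π.map Prod.snd = ENNReal.ofReal p • μ₁ + ENNReal.ofReal (1 - p) • μ₂)
    (hcost : ∫⁻ p, ENNReal.ofReal |p.1 - p.2| ∂π ≤ ENNReal.ofReal K) :
    ∃ a b : ℝ, 0 ≤ a ∧ 0 ≤ b ∧ p * a + (1 - p) * b ≤ K ∧
      ((π.map Prod.fst) (Set.Iic 0)).toReal ≤ p * robustVal μ₁ a + (1 - p) * robustVal μ₂ b := by
  have hp1 := hp.1
  have hp2 := sub_pos.2 hp.2
  have hprob := isProbabilityMeasure_mixture μ₁ μ₂ hp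
  have : IsProbabilityMeasure π := by
    rw [← hsnd] at hprob
    exact Measure.isProbabilityMeasure_of_map Prod.snd
  set ρ := π.map Prod.swap with hρ
  have : IsProbabilityMeasure ρ :=
    Measure.isProbabilityMeasure_map measurable_swap.aemeasurable
  set κ := ρ.condKernel
  have hfst : ρ.fst = ENNReal.ofReal p • μ₁ + ENNReal.ofReal (1 - p) • μ₂ := by
    rw [← hsnd, hρ, Measure.fst_map_swap, Measure.snd]
  have hπ : π = ENNReal.ofReal p • (μ₁ ⊗ₘ κ).map Prod.swap +
      ENNReal.ofReal (1 - p) • (μ₂ ⊗ₘ κ).map Prod.swap := by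
    rw [← Measure.map_smul, ← Measure.map_smul, ← Measure.map_add _ _ measurable_swap,
      ← Measure.compProd_smul_left, ← Measure.compProd_smul_left, ← Measure.compProd_add_left,
      ← hfst, ρ.disintegrate, hρ, Measure.map_map measurable_swap measurable_swap]
    simp
  have marg : ∀ (m : Measure ℝ) [IsProbabilityMeasure m],
      ((m ⊗ₘ κ).map Prod.swap).map Prod.snd = m := by
    intro m _
    rw [Measure.map_map measurable_snd measurable_swap]
    exact Measure.fst_compProd m κ
  set π₁ := (μ₁ ⊗ₘ κ).map Prod.swap with hπ₁
  set π₂ := (μ₂ ⊗ₘ κ).map Prod.swap with hπ₂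
  have : IsProbabilityMeasure π₁ := Measure.isProbabilityMeasure_map measurable_swap.aemeasurable
  have : IsProbabilityMeasure π₂ := Measure.isProbabilityMeasure_map measurable_swap.aemeasurable
  have hm₁ := marg μ₁
  have hm₂ := marg μ₂
  rw [hπ] at hcost
  simp only [lintegral_add_measure, lintegral_smul_measure, smul_eq_mul] at hcost
  set C₁ := ∫⁻ p, ENNReal.ofReal |p.1 - p.2| ∂π₁
  set C₂ := ∫⁻ p, ENNReal.ofReal |p.1 - p.2| ∂π₂
  have hfin := ne_top_of_le_ne_top ENNReal.ofReal_ne_top hcost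
  have hC₁ : C₁ ≠ ⊤ := by
    intro h
    simp [h, ENNReal.mul_top, hp1] at hfin
  have hC₂ : C₂ ≠ ⊤ := by
    intro h
    simp [h, ENNReal.mul_top, hp.2] at hfin
  refine ⟨C₁.toReal, C₂.toReal, ENNReal.toReal_nonneg, ENNReal.toReal_nonneg, ?_, ?_⟩
  · rwa [← ENNReal.ofReal_le_ofReal_iff hK, ENNReal.ofReal_add (by positivity) (by positivity),
      ENNReal.ofReal_mul hp1.le, ENNReal.ofReal_mul hp2.le, ENNReal.ofReal_toReal hC₁,
      ENNReal.ofReal_toReal hC₂]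
  · have h₁ := map_fst_apply_le_robustVal π₁ ENNReal.toReal_nonneg (ENNReal.ofReal_toReal hC₁).ge
    have h₂ := map_fst_apply_le_robustVal π₂ ENNReal.toReal_nonneg (ENNReal.ofReal_toReal hC₂).ge
    rw [hm₁] at h₁
    rw [hm₂] at h₂
    have : IsProbabilityMeasure (π₁.map Prod.fst) :=
      Measure.isProbabilityMeasure_map measurable_fst.aemeasurable
    have : IsProbabilityMeasure (π₂.map Prod.fst) :=
      Measure.isProbabilityMeasure_map measurable_fst.aemeasurable
    rw [hπ, Measure.map_add _ _ measurable_fst, Measure.map_smul, Measure.map_smul,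
      toReal_mixture_apply _ _ hp]
    gcongr

/-- **Mixture.** If the law `μ` is the mixture of `μ₁` and `μ₂` with weights `p` and
`1 - p`, then for every `δ ≥ 0`,
`v(δ) = sup {p v₁(δc₁) + (1-p) v₂(δc₂) : c₁, c₂ ≥ 0, p c₁ + (1-p) c₂ ≤ 1}`;
in particular `p v₁(δ/p) + (1-p) v₂(0) ≤ v(δ) ≤ p v₁(δ/p) + (1-p) v₂(δ/(1-p))`. -/
theorem robustVal_mixture (μ₁ μ₂ : Measure ℝ) [IsProbabilityMeasure μ₁]
    [IsProbabilityMeasure μ₂] (p : ℝ) (hp : p ∈ Set.Ioo (0:ℝ) 1)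
    (μ : Measure ℝ) (hμ : μ = ENNReal.ofReal p • μ₁ + ENNReal.ofReal (1 - p) • μ₂) :
    ∀ δ : ℝ, 0 ≤ δ →
      robustVal μ δ = sSup {w : ℝ | ∃ c₁ c₂ : ℝ, 0 ≤ c₁ ∧ 0 ≤ c₂ ∧
        p * c₁ + (1 - p) * c₂ ≤ 1 ∧
        w = p * robustVal μ₁ (δ * c₁) + (1 - p) * robustVal μ₂ (δ * c₂)} ∧
      p * robustVal μ₁ (δ / p) + (1 - p) * robustVal μ₂ 0 ≤ robustVal μ δ ∧
      robustVal μ δ ≤ p * robustVal μ₁ (δ / p) + (1 - p) * robustVal μ₂ (δ / (1 - p)) := by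
  intro δ hδ
  have hp1 := hp.1
  have hp2 := sub_pos.2 hp.2
  have := isProbabilityMeasure_mixture μ₁ μ₂ hp
  rw [← hμ] at this
  set S := {w : ℝ | ∃ c₁ c₂ : ℝ, 0 ≤ c₁ ∧ 0 ≤ c₂ ∧
        p * c₁ + (1 - p) * c₂ ≤ 1 ∧
        w = p * robustVal μ₁ (δ * c₁) + (1 - p) * robustVal μ₂ (δ * c₂)}
  have hub : ∀ w ∈ S, w ≤ robustVal μ δ := by
    rintro _ ⟨c₁, c₂, hc₁, hc₂, hc, rfl⟩
    refine (mixture_robustVal_le μ₁ μ₂ hp (mul_nonneg hδ hc₁) (mul_nonneg hδ hc₂)).trans ?_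
    rw [← hμ]
    refine robustVal_mono (by positivity) ?_
    nlinarith
  have hne : S.Nonempty := ⟨_, 0, 0, le_rfl, le_rfl, by simp, rfl⟩
  have hle : robustVal μ δ ≤ sSup S := by
    rcases hδ.eq_or_lt with rfl | hpos
    · refine le_csSup ⟨_, hub⟩ ⟨0, 0, le_rfl, le_rfl, by simp, ?_⟩
      simp only [mul_zero, robustVal_zero, hμ, toReal_mixture_apply _ _ hp]
    · refine robustVal_le fun ν _ hW => ?_
      have hscaled : ∀ t ∈ Set.Ioo (0:ℝ) 1, t * (ν (Set.Iic 0)).toReal ≤ sSup S := by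
        intro t ht
        have ht0 := ht.1
        have hlt : δ < δ / t := by
          rw [lt_div_iff₀ ht0]
          nlinarith [ht.2]
        obtain ⟨π, rfl, hsnd, hcost⟩ := exists_coupling_of_wasserstein1_lt
          (hW.trans_lt ((ENNReal.ofReal_lt_ofReal_iff (hpos.trans hlt)).2 hlt))
        obtain ⟨a, b, ha, hb, hab, hv⟩ := exists_le_mixture_robustVal μ₁ μ₂ hp
          (hpos.trans hlt).le π (hsnd.trans hμ) hcost.le
        rw [le_div_iff₀ ht0] at hab
        have hmem : p * robustVal μ₁ (t * a) + (1 - p) * robustVal μ₂ (t * b) ∈ S := by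
          refine ⟨t * a / δ, t * b / δ, by positivity, by positivity, ?_, ?_⟩
          · rw [← mul_div_assoc, ← mul_div_assoc, ← add_div, div_le_one hpos]
            linarith
          · rw [mul_div_cancel₀ _ hpos.ne', mul_div_cancel₀ _ hpos.ne']
        refine le_trans ?_ (le_csSup ⟨_, hub⟩ hmem)
        have h₁ := mul_le_mul_of_nonneg_left (mul_robustVal_le μ₁ ht ha) hp1.le
        have h₂ := mul_le_mul_of_nonneg_left (mul_robustVal_le μ₂ ht hb) hp2.le
        linarith [mul_le_mul_of_nonneg_left hv ht0.le]
      by_contra! hcon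
      have hS0 : 0 ≤ sSup S := by
        obtain ⟨w, hw⟩ := hne
        refine le_trans ?_ (le_csSup ⟨_, hub⟩ hw)
        obtain ⟨c₁, c₂, -, -, -, rfl⟩ := hw
        exact add_nonneg (mul_nonneg hp1.le (robustVal_nonneg _ _))
          (mul_nonneg hp2.le (robustVal_nonneg _ _))
      obtain ⟨r, hr₁, hr₂⟩ := exists_between hcon
      have hm := hS0.trans_lt hcon
      have h := hscaled (r / (ν (Set.Iic 0)).toReal)
        ⟨div_pos (hS0.trans_lt hr₁) hm, (div_lt_one hm).2 hr₂⟩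
      rw [div_mul_cancel₀ _ hm.ne'] at h
      exact h.not_gt hr₁
  refine ⟨le_antisymm hle (csSup_le hne hub), hub _ ⟨1 / p, 0, by positivity, le_rfl, ?_, ?_⟩,
    hle.trans (csSup_le hne ?_)⟩
  · simp [hp1.ne']
  · simp [div_eq_mul_inv]
  · rintro _ ⟨c₁, c₂, hc₁, hc₂, hc, rfl⟩
    have h₁ : δ * c₁ ≤ δ / p := by
      rw [le_div_iff₀ hp1]
      nlinarith [mul_nonneg hp2.le hc₂]
    have h₂ : δ * c₂ ≤ δ / (1 - p) := by
      rw [le_div_iff₀ hp2]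
      nlinarith [mul_nonneg hp1.le hc₁]
    exact add_le_add
      (mul_le_mul_of_nonneg_left (robustVal_mono (mul_nonneg hδ hc₁) h₁) hp1.le)
      (mul_le_mul_of_nonneg_left (robustVal_mono (mul_nonneg hδ hc₂) h₂) hp2.le)
end

section
/- Let Y_1 be a real random variable, η > 0, and Y_2 = Y_1 + η. If for some δ > 0 the optimal values coincide, v_1(δ) = v_2(δ), then v_1(δ) = v_2(δ) = 1. -/
open MeasureTheory
open scoped ENNReal

/-- Moving a part `ρ` of a probability measure `μ` onto `(-∞, 0]` costs the integral of the positive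
part against `ρ`. -/
theorem exists_wasserstein1_le_of_le {μ ρ : Measure ℝ} [IsProbabilityMeasure μ] (hρ : ρ ≤ μ)
    {c : ℝ≥0∞} (hc : ∫⁻ y, ENNReal.ofReal y ∂ρ ≤ c) :
    ∃ ν : Measure ℝ, IsProbabilityMeasure ν ∧ wasserstein1 ν μ ≤ c ∧
      ρ Set.univ ≤ ν (Set.Iic 0) := by
  have : IsFiniteMeasure ρ := isFiniteMeasure_of_le μ hρ
  have hf : Measurable (fun y : ℝ => (min y 0, y)) := by fun_prop
  have hg : Measurable (fun y : ℝ => (y, y)) := by fun_prop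
  set π : Measure (ℝ × ℝ) :=
    ρ.map (fun y => (min y 0, y)) + (μ - ρ).map (fun y => (y, y)) with hπ
  have hsnd : π.map Prod.snd = μ := by
    rw [hπ, Measure.map_add _ _ measurable_snd, Measure.map_map measurable_snd hf,
      Measure.map_map measurable_snd hg]
    change ρ.map id + (μ - ρ).map id = μ
    rw [Measure.map_id, Measure.map_id, add_comm, Measure.sub_add_cancel_of_le hρ]
  have : IsProbabilityMeasure π := ⟨by
    rw [← Set.preimage_univ (f := (Prod.snd : ℝ × ℝ → ℝ)),
      ← Measure.map_apply measurable_snd MeasurableSet.univ, hsnd, measure_univ]⟩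
  refine ⟨π.map Prod.fst, Measure.isProbabilityMeasure_map measurable_fst.aemeasurable, ?_, ?_⟩
  · refine (iInf_le_of_le π <| iInf_le_of_le rfl <| iInf_le_of_le hsnd le_rfl).trans ?_
    have hm : Measurable (fun p : ℝ × ℝ => ENNReal.ofReal |p.1 - p.2|) :=
      ENNReal.measurable_ofReal.comp (measurable_fst.sub measurable_snd).abs
    rw [hπ, lintegral_add_measure, lintegral_map hm hf, lintegral_map hm hg]
    simp only [sub_self, abs_zero, ENNReal.ofReal_zero, lintegral_zero, add_zero]
    refine (lintegral_mono fun y => ?_).trans hc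
    rcases le_total y 0 with h | h
    · simp [h]
    · simp [h, abs_of_nonneg h]
  · rw [Measure.map_apply measurable_fst measurableSet_Iic, hπ, Measure.add_apply,
      Measure.map_apply hf (measurable_fst measurableSet_Iic)]
    refine le_add_right (measure_mono fun y _ => ?_)
    simp

theorem bddAbove_robustVal_set (μ : Measure ℝ) (δ : ℝ) :
    BddAbove {v : ℝ | ∃ ν : Measure ℝ, IsProbabilityMeasure ν ∧
      wasserstein1 ν μ ≤ ENNReal.ofReal δ ∧ v = (ν (Set.Iic 0)).toReal} := by
  refine ⟨1, ?_⟩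
  rintro _ ⟨ν, hν, -, rfl⟩
  exact measureReal_le_one

theorem le_robustVal_of_le {μ ρ : Measure ℝ} [IsProbabilityMeasure μ] (hρ : ρ ≤ μ)
    {δ : ℝ} (hδ : 0 < δ) (hc : ∫⁻ y, ENNReal.ofReal y ∂ρ ≤ ENNReal.ofReal δ) :
    ρ.real Set.univ ≤ robustVal μ δ := by
  obtain ⟨ν, hν, hW, hle⟩ := exists_wasserstein1_le_of_le hρ hc
  rw [robustVal, if_neg hδ.ne']
  exact (ENNReal.toReal_mono (measure_ne_top _ _) hle).trans
    (le_csSup (bddAbove_robustVal_set μ δ) ⟨ν, hν, hW, rfl⟩)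

theorem robustVal_le_one {μ : Measure ℝ} {δ : ℝ} (hδ : 0 < δ) : robustVal μ δ ≤ 1 := by
  rw [robustVal, if_neg hδ.ne']
  refine Real.sSup_le ?_ zero_le_one
  rintro _ ⟨ν, hν, -, rfl⟩
  exact measureReal_le_one

/-- A coupling of `ν` and `μ` determines the part of `μ` that is transported onto `(-∞, 0]`. -/
theorem exists_le_of_wasserstein1_lt {μ ν : Measure ℝ} {c : ℝ≥0∞} (h : wasserstein1 ν μ < c) :
    ∃ ρ ≤ μ, ∫⁻ y, ENNReal.ofReal y ∂ρ ≤ c ∧ ρ Set.univ = ν (Set.Iic 0) := by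
  simp only [wasserstein1, iInf_lt_iff] at h
  obtain ⟨π, h1, h2, hπ⟩ := h
  have hS : MeasurableSet (Prod.fst ⁻¹' Set.Iic 0 : Set (ℝ × ℝ)) :=
    measurable_fst measurableSet_Iic
  refine ⟨(π.restrict (Prod.fst ⁻¹' Set.Iic 0)).map Prod.snd, ?_, ?_, ?_⟩
  · rw [← h2]
    exact Measure.map_mono Measure.restrict_le_self measurable_snd
  · rw [lintegral_map ENNReal.measurable_ofReal measurable_snd]
    refine ((setLIntegral_mono' hS fun p hp => ?_).trans (setLIntegral_le_lintegral _ _)).trans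
      hπ.le
    have hp : p.1 ≤ 0 := hp
    refine ENNReal.ofReal_le_ofReal ?_
    linarith [neg_abs_le (p.1 - p.2)]
  · rw [Measure.map_apply measurable_snd MeasurableSet.univ, Set.preimage_univ,
      Measure.restrict_apply_univ, ← h1, Measure.map_apply measurable_fst measurableSet_Iic]

theorem exists_le_of_lt_robustVal {μ : Measure ℝ} [IsProbabilityMeasure μ] {δ a : ℝ} (hδ : 0 < δ)
    (ha : a < robustVal μ δ) :
    ∃ ρ ≤ μ, ∫⁻ y, ENNReal.ofReal y ∂ρ ≤ ENNReal.ofReal δ ∧ a < ρ.real Set.univ := by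
  rcases lt_or_ge a 0 with h0 | h0
  · exact ⟨0, Measure.zero_le μ, by simp, by simpa using h0⟩
  rw [robustVal, if_neg hδ.ne'] at ha
  obtain ⟨ν₀, hν₀, hW₀, -⟩ := exists_wasserstein1_le_of_le (μ := μ) (Measure.zero_le μ)
    (c := ENNReal.ofReal δ) (by simp)
  obtain ⟨_, ⟨ν, hν, hW, rfl⟩, hap⟩ := exists_lt_of_lt_csSup (by exact ⟨_, ν₀, hν₀, hW₀, rfl⟩) ha
  set p := (ν (Set.Iic 0)).toReal with hp
  have hp1 : p ≤ 1 := measureReal_le_one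
  set s := 1 - (p - a) / 2 with hs
  have hs0 : 0 < s := by rw [hs]; linarith
  have hs1 : s < 1 := by rw [hs]; linarith
  have hsp : a < s * p := by rw [hs]; nlinarith
  have hlt : δ < δ / s := by rw [lt_div_iff₀ hs0]; nlinarith
  obtain ⟨ρ, hρ, hcost, hmass⟩ := exists_le_of_wasserstein1_lt
    (hW.trans_lt ((ENNReal.ofReal_lt_ofReal_iff (hδ.trans hlt)).2 hlt))
  refine ⟨ENNReal.ofReal s • ρ, ?_, ?_, ?_⟩
  · refine Measure.le_iff.2 fun A _ => ?_
    rw [Measure.smul_apply, smul_eq_mul]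
    exact (mul_le_of_le_one_left zero_le (ENNReal.ofReal_le_one.2 hs1.le)).trans (hρ A)
  · rw [lintegral_smul_measure, smul_eq_mul]
    refine (mul_le_mul_right hcost _).trans ?_
    rw [← ENNReal.ofReal_mul hs0.le, mul_div_cancel₀ _ hs0.ne']
  · rwa [measureReal_ennreal_smul_apply, ENNReal.toReal_ofReal hs0.le, measureReal_def, hmass]

/-- Mixing a feasible part of `μ` with the restriction of `μ` to `(-∞, M]`. -/
theorem mix_le_robustVal {μ ρ : Measure ℝ} [IsProbabilityMeasure μ] (hρ : ρ ≤ μ)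
    {δ c t M : ℝ} (hδ : 0 < δ) (hc0 : 0 ≤ c) (ht0 : 0 ≤ t) (ht1 : t ≤ 1) (hM : 0 ≤ M)
    (hc : ∫⁻ y, ENNReal.ofReal y ∂ρ ≤ ENNReal.ofReal c) (hle : (1 - t) * c + t * M ≤ δ) :
    (1 - t) * ρ.real Set.univ + t * μ.real (Set.Iic M) ≤ robustVal μ δ := by
  have : IsFiniteMeasure ρ := isFiniteMeasure_of_le μ hρ
  have ht1' : 0 ≤ 1 - t := sub_nonneg.2 ht1
  have hmono : ENNReal.ofReal (1 - t) • ρ + ENNReal.ofReal t • μ.restrict (Set.Iic M) ≤ μ := by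
    refine Measure.le_iff.2 fun A _ => ?_
    simp only [Measure.add_apply, Measure.smul_apply, smul_eq_mul]
    calc _ ≤ ENNReal.ofReal (1 - t) * μ A + ENNReal.ofReal t * μ A :=
          add_le_add (mul_le_mul_right (hρ A) _)
            (mul_le_mul_right (Measure.restrict_le_self A) _)
      _ = μ A := by
          rw [← add_mul, ← ENNReal.ofReal_add ht1' ht0, sub_add_cancel, ENNReal.ofReal_one, one_mul]
  have hM' : ∫⁻ y in Set.Iic M, ENNReal.ofReal y ∂μ ≤ ENNReal.ofReal M := by
    calc _ ≤ ∫⁻ _ in Set.Iic M, ENNReal.ofReal M ∂μ :=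
          setLIntegral_mono' measurableSet_Iic fun y hy => ENNReal.ofReal_le_ofReal hy
      _ ≤ ∫⁻ _, ENNReal.ofReal M ∂μ := setLIntegral_le_lintegral _ _
      _ = ENNReal.ofReal M := by simp
  have hcost : ∫⁻ y, ENNReal.ofReal y
      ∂(ENNReal.ofReal (1 - t) • ρ + ENNReal.ofReal t • μ.restrict (Set.Iic M)) ≤
      ENNReal.ofReal δ := by
    rw [lintegral_add_measure, lintegral_smul_measure, lintegral_smul_measure, smul_eq_mul,
      smul_eq_mul]
    refine (add_le_add (mul_le_mul_right hc _) (mul_le_mul_right hM' _)).trans ?_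
    rw [← ENNReal.ofReal_mul ht1', ← ENNReal.ofReal_mul ht0,
      ← ENNReal.ofReal_add (mul_nonneg ht1' hc0) (mul_nonneg ht0 hM)]
    exact ENNReal.ofReal_le_ofReal hle
  refine le_trans (le_of_eq ?_) (le_robustVal_of_le hmono hδ hcost)
  simp only [measureReal_def, Measure.add_apply, Measure.smul_apply, smul_eq_mul,
    Measure.restrict_apply_univ]
  rw [ENNReal.toReal_add (by finiteness) (by finiteness), ENNReal.toReal_mul, ENNReal.toReal_mul,
    ENNReal.toReal_ofReal ht1', ENNReal.toReal_ofReal ht0]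

theorem lintegral_ofReal_add_le {ρ : Measure ℝ} {η : ℝ} (hη : 0 ≤ η) :
    ∫⁻ y, ENNReal.ofReal y ∂ρ + ENNReal.ofReal η * ρ (Set.Ioi 0) ≤
      ∫⁻ y, ENNReal.ofReal (y + η) ∂ρ := by
  rw [← lintegral_indicator_const measurableSet_Ioi,
    ← lintegral_add_left ENNReal.measurable_ofReal]
  refine lintegral_mono fun y => ?_
  rcases le_or_gt y 0 with h | h
  · simp [h, ENNReal.ofReal_of_nonpos h]
  · simp [h, ENNReal.ofReal_add h.le hη]

theorem exists_pos_lt_measureReal_Iic (μ : Measure ℝ) [IsProbabilityMeasure μ] {v : ℝ}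
    (hv : v < 1) : ∃ M : ℝ, 0 < M ∧ v < μ.real (Set.Iic M) := by
  have h : Filter.Tendsto (fun M : ℝ => μ.real (Set.Iic M)) Filter.atTop (nhds 1) := by
    have := (ENNReal.tendsto_toReal (measure_ne_top μ Set.univ)).comp
      (tendsto_measure_Iic_atTop μ)
    rw [measure_univ, ENNReal.toReal_one] at this
    exact this
  exact ((Filter.eventually_gt_atTop 0).and (h.eventually (lt_mem_nhds hv))).exists

/-- Parts of a translated measure are translates of parts of the measure. -/
theorem exists_le_of_lt_robustVal_map_add {μ : Measure ℝ} [IsProbabilityMeasure μ] {η δ a : ℝ}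
    (hδ : 0 < δ) (ha : a < robustVal (μ.map (fun t => t + η)) δ) :
    ∃ ρ ≤ μ, ∫⁻ y, ENNReal.ofReal (y + η) ∂ρ ≤ ENNReal.ofReal δ ∧ a < ρ.real Set.univ := by
  have hadd : Measurable (fun t : ℝ => t + η) := by fun_prop
  have hsub : Measurable (fun t : ℝ => t - η) := by fun_prop
  have : IsProbabilityMeasure (μ.map (fun t => t + η)) :=
    Measure.isProbabilityMeasure_map hadd.aemeasurable
  obtain ⟨ρ, hρ, hcost, hmass⟩ := exists_le_of_lt_robustVal hδ ha
  refine ⟨ρ.map (fun t => t - η), ?_, ?_, ?_⟩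
  · refine (Measure.map_mono hρ hsub).trans (le_of_eq ?_)
    rw [Measure.map_map hsub hadd]
    convert Measure.map_id
    ext t
    simp
  · rw [lintegral_map hadd.ennreal_ofReal hsub]
    simpa using hcost
  · rwa [measureReal_def, Measure.map_apply hsub MeasurableSet.univ, Set.preimage_univ]

theorem robustVal_map_add_lt {μ : Measure ℝ} [IsProbabilityMeasure μ] {η δ : ℝ} (hη : 0 < η)
    (hδ : 0 < δ) (hv : robustVal (μ.map (fun t => t + η)) δ < 1) :
    robustVal (μ.map (fun t => t + η)) δ < robustVal μ δ := by
  set v := robustVal (μ.map (fun t => t + η)) δ with hvdef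
  obtain ⟨M, hM, hq⟩ := exists_pos_lt_measureReal_Iic μ hv
  set q := μ.real (Set.Iic M)
  obtain ⟨t₀, ht₀, ht₀', hbudget₀⟩ : ∃ t : ℝ, 0 < t ∧ t < 1 ∧ t * M ≤ δ := by
    refine ⟨δ / (δ + M), by positivity, by rw [div_lt_one (by positivity)]; linarith, ?_⟩
    rw [div_mul_eq_mul_div, div_le_iff₀ (by positivity)]
    nlinarith
  obtain ⟨c, hc, hcv⟩ : ∃ c : ℝ, 0 < c ∧ 4 * c = t₀ * (q - v) :=
    ⟨t₀ * (q - v) / 4, by have := sub_pos.2 hq; positivity, by ring⟩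
  obtain ⟨t₁, ht₁, ht₁', hbudget₁⟩ : ∃ t : ℝ, 0 < t ∧ t < 1 ∧ t * M = (1 - t) * (η * c) := by
    refine ⟨η * c / (M + η * c), by positivity, ?_, ?_⟩
    · rw [div_lt_one (by positivity)]; linarith
    · field_simp
      ring
  obtain ⟨ε, hε, hε₀, hε₁⟩ : ∃ ε : ℝ, 0 < ε ∧ ε ≤ c ∧ ε ≤ t₁ * (q - v) / 2 := by
    have := sub_pos.2 hq
    exact ⟨min c (t₁ * (q - v) / 2), by positivity, min_le_left _ _, min_le_right _ _⟩
  obtain ⟨ρ, hρ, hcost, hmass⟩ := exists_le_of_lt_robustVal_map_add (μ := μ) (η := η) (a := v - ε)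
    hδ (by rw [← hvdef]; linarith)
  have : IsFiniteMeasure ρ := isFiniteMeasure_of_le μ hρ
  have hsave := (lintegral_ofReal_add_le hη.le).trans hcost
  set m := ρ.real (Set.Ioi 0) with hm
  have hm0 : 0 ≤ m := measureReal_nonneg
  rw [← ofReal_measureReal, ← ENNReal.ofReal_mul hη.le, ← hm] at hsave
  rcases le_or_gt c m with h | h
  · have hηm : η * m ≤ δ := (ENNReal.ofReal_le_ofReal_iff hδ.le).1 (le_add_self.trans hsave)
    have hcost' : ∫⁻ y, ENNReal.ofReal y ∂ρ ≤ ENNReal.ofReal (δ - η * m) := by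
      rw [ENNReal.ofReal_sub _ (by positivity)]
      exact ENNReal.le_sub_of_add_le_right ENNReal.ofReal_ne_top hsave
    have hcm : (1 - t₁) * (η * c) ≤ (1 - t₁) * (η * m) :=
      mul_le_mul_of_nonneg_left (mul_le_mul_of_nonneg_left h hη.le) (by linarith)
    have := mix_le_robustVal hρ hδ (sub_nonneg.2 hηm) ht₁.le ht₁'.le hM.le hcost' (by nlinarith)
    refine lt_of_lt_of_le ?_ this
    have := mul_pos ht₁ hε
    have := mul_le_mul_of_nonneg_left hmass.le (sub_nonneg.2 ht₁'.le)
    change v < (1 - t₁) * ρ.real Set.univ + t₁ * q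
    nlinarith
  · have hcost' : ∫⁻ y, ENNReal.ofReal y ∂(ρ.restrict (Set.Iic 0)) ≤ ENNReal.ofReal 0 := by
      rw [ENNReal.ofReal_zero, setLIntegral_congr_fun (g := 0) measurableSet_Iic
        fun y hy => ENNReal.ofReal_of_nonpos hy]
      simp
    have hsplit : (ρ.restrict (Set.Iic 0)).real Set.univ = ρ.real Set.univ - m := by
      rw [measureReal_restrict_apply_univ, hm, ← Set.compl_Iic,
        measureReal_compl measurableSet_Iic]
      ring
    have := mix_le_robustVal (Measure.restrict_le_self.trans hρ) hδ le_rfl ht₀.le ht₀'.le hM.le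
      hcost' (by linarith)
    refine lt_of_lt_of_le ?_ this
    have := mul_pos ht₀ hc
    have := mul_le_mul_of_nonneg_left
      (show v - 2 * c ≤ ρ.real Set.univ - m by linarith) (sub_nonneg.2 ht₀'.le)
    rw [hsplit]
    change v < (1 - t₀) * (ρ.real Set.univ - m) + t₀ * q
    nlinarith

/-- **Strict monotonicity.** If `Y₂ = Y₁ + η` with `η > 0` and for some `δ > 0` the optimal
values coincide, then both equal `1`. -/
theorem robustVal_strict (μ : Measure ℝ) [IsProbabilityMeasure μ] (η : ℝ) (hη : 0 < η)
    (δ : ℝ) (hδ : 0 < δ)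
    (heq : robustVal μ δ = robustVal (μ.map (fun t => t + η)) δ) :
    robustVal μ δ = 1 ∧ robustVal (μ.map (fun t => t + η)) δ = 1 := by
  have h : robustVal (μ.map (fun t => t + η)) δ = 1 :=
    (robustVal_le_one hδ).eq_of_not_lt fun hlt => (robustVal_map_add_lt hη hδ hlt).ne' heq
  exact ⟨heq.trans h, h⟩
end
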